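/- arXiv:2201.08084 — 4 statements merged into one kernel-verified Lean document; each statement's English description precedes it below -/
import Mathlib

section
/- Let q be a prime power and let n, k₁, k₂, t be positive integers with k₁ ≥ t, k₂ ≥ t and n ≥ k₁ + k₂ + 3. Suppose F₁ ⊆ M(k₁,n) and F₂ ⊆ M(k₂,n) are cross t-intersecting families whose product of sizes is maximum, i.e. |F₁|·|F₂| ≥ |G₁|·|G₂| for every pair of cross t-intersecting families G₁ ⊆ M(k₁,n), G₂ ⊆ M(k₂,n). Then there exists a t-flat in AG(n,q) contained in every member of F₁ and every member of F₂. -/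
open Module Set

/-- Gaussian binomial coefficient `[n k]_q`, as a rational number, via the
product formula `∏_{0 ≤ i < k} (q^{n-i} - 1)/(q^{k-i} - 1)`. -/
noncomputable def gaussQ (q n k : ℕ) : ℚ :=
  ∏ i ∈ Finset.range k, ((q : ℚ) ^ (n - i) - 1) / ((q : ℚ) ^ (k - i) - 1)

/-- `A` is a `k`-flat of the affine space `AG(n, q)` (with `q = |𝔽|`):
a coset `x + P` of a `k`-dimensional linear subspace `P` of `𝔽^n`. -/
def IsFlat (𝔽 : Type) [Field 𝔽] {n : ℕ} (k : ℕ) (A : Set (Fin n → 𝔽)) : Prop :=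
  ∃ (P : Submodule 𝔽 (Fin n → 𝔽)) (x : Fin n → 𝔽),
    Module.finrank 𝔽 ↥P = k ∧ A = {v | v - x ∈ P}

/-- `A` is a flat (in particular nonempty) of dimension at least `t`. -/
def DimGe (𝔽 : Type) [Field 𝔽] {n : ℕ} (t : ℕ) (A : Set (Fin n → 𝔽)) : Prop :=
  ∃ j, t ≤ j ∧ IsFlat 𝔽 j A

/-- Two families of flats are cross `t`-intersecting. -/
def CrossT (𝔽 : Type) [Field 𝔽] {n : ℕ} (t : ℕ)
    (F1 F2 : Set (Set (Fin n → 𝔽))) : Prop :=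
  ∀ A ∈ F1, ∀ B ∈ F2, DimGe 𝔽 t (A ∩ B)

/-- A pair of families is trivial: some `t`-flat is contained in every member. -/
def TrivialPair (𝔽 : Type) [Field 𝔽] {n : ℕ} (t : ℕ)
    (F1 F2 : Set (Set (Fin n → 𝔽))) : Prop :=
  ∃ T : Set (Fin n → 𝔽), IsFlat 𝔽 t T ∧ (∀ A ∈ F1, T ⊆ A) ∧ (∀ B ∈ F2, T ⊆ B)

/-- `T` is a `t`-cover of the family `F`: `dim (T ∩ A) ≥ t` for all `A ∈ F`. -/
def IsTCover (𝔽 : Type) [Field 𝔽] {n : ℕ} (t : ℕ) (T : Set (Fin n → 𝔽))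
    (F : Set (Set (Fin n → 𝔽))) : Prop :=
  ∀ A ∈ F, DimGe 𝔽 t (T ∩ A)

/-- `τ_t(F)`: the minimum dimension of a `t`-cover of `F`. -/
noncomputable def tauT (𝔽 : Type) [Field 𝔽] {n : ℕ} (t : ℕ)
    (F : Set (Set (Fin n → 𝔽))) : ℕ :=
  sInf {x | ∃ T : Set (Fin n → 𝔽), IsFlat 𝔽 x T ∧ IsTCover 𝔽 t T F}

/-- `A₁(M, T; k, t) = {F ∈ M(k,n) : T ⊆ F, dim(F ∩ M) ≥ t + 1}`. -/
def A1 (𝔽 : Type) [Field 𝔽] {n : ℕ} (M T : Set (Fin n → 𝔽)) (k t : ℕ) :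
    Set (Set (Fin n → 𝔽)) :=
  {F | IsFlat 𝔽 k F ∧ T ⊆ F ∧ DimGe 𝔽 (t + 1) (F ∩ M)}

/-- `A₂(M, T; k, t) = {F ∈ M(k,n) : T ⊆ F} ∪ {F ∈ M(k,n) : F ⊆ M, dim(F ∩ T) = t - 1}`. -/
def A2 (𝔽 : Type) [Field 𝔽] {n : ℕ} (M T : Set (Fin n → 𝔽)) (k t : ℕ) :
    Set (Set (Fin n → 𝔽)) :=
  {F | IsFlat 𝔽 k F ∧ T ⊆ F} ∪ {F | IsFlat 𝔽 k F ∧ F ⊆ M ∧ IsFlat 𝔽 (t - 1) (F ∩ T)}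

/-- `A₃(S; k) = {F ∈ M(k,n) : S ⊆ F}`. -/
def A3 (𝔽 : Type) [Field 𝔽] {n : ℕ} (S : Set (Fin n → 𝔽)) (k : ℕ) :
    Set (Set (Fin n → 𝔽)) :=
  {F | IsFlat 𝔽 k F ∧ S ⊆ F}

/-- `A₄(S; k, t) = {F ∈ M(k,n) : dim(F ∩ S) ≥ t}`. -/
def A4 (𝔽 : Type) [Field 𝔽] {n : ℕ} (S : Set (Fin n → 𝔽)) (k t : ℕ) :
    Set (Set (Fin n → 𝔽)) :=
  {F | IsFlat 𝔽 k F ∧ DimGe 𝔽 t (F ∩ S)}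

/-! ### Gaussian numbers -/

/-- The number of `K`-dimensional subspaces of a `w`-dimensional space over the field with `q`
elements that contain a fixed `s`-dimensional subspace. -/
noncomputable def flagCount (q : ℚ) (w K s : ℕ) : ℚ :=
  ∏ i ∈ Finset.range (K - s), (q ^ w - q ^ (s + i)) / (q ^ K - q ^ (s + i))

lemma flagCount_self (q : ℚ) (w K : ℕ) : flagCount q w K K = 1 := by
  simp [flagCount]

lemma flagCount_succ (q : ℚ) {w K s : ℕ} (h : s < K) :
    flagCount q w K s = (q ^ w - q ^ s) / (q ^ K - q ^ s) * flagCount q w K (s + 1) := by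
  obtain ⟨j, rfl⟩ : ∃ j, K = s + j + 1 := ⟨K - s - 1, by omega⟩
  have e1 : s + j + 1 - s = j + 1 := by omega
  have e2 : s + j + 1 - (s + 1) = j := by omega
  simp only [flagCount, e1, e2]
  rw [Finset.prod_range_succ', mul_comm]
  simp [add_assoc, add_comm, add_left_comm]

lemma flagCount_pos {q : ℚ} (hq : 2 ≤ q) {w K : ℕ} (hw : K ≤ w) (s : ℕ) :
    0 < flagCount q w K s := by
  refine Finset.prod_pos fun i hi => ?_
  rw [Finset.mem_range] at hi
  have h1 : q ^ (s + i) < q ^ K := pow_lt_pow_right₀ (by linarith) (by omega)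
  have h2 : q ^ K ≤ q ^ w := pow_le_pow_right₀ (by linarith) hw
  exact div_pos (by linarith) (by linarith)

lemma flagCount_succ_mul_le {q : ℚ} (hq : 2 ≤ q) {w K s : ℕ} (hw : K ≤ w) (h : s < K) :
    flagCount q w K (s + 1) * q ^ (w - K) ≤ flagCount q w K s := by
  rw [flagCount_succ q h, mul_comm]
  refine mul_le_mul_of_nonneg_right ?_ (flagCount_pos hq hw _).le
  have h1 : q ^ s < q ^ K := pow_lt_pow_right₀ (by linarith) h
  rw [le_div_iff₀ (by linarith), mul_sub, ← pow_add, Nat.sub_add_cancel hw]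
  have h2 : 1 ≤ q ^ (w - K) := one_le_pow₀ (by linarith)
  have h3 : 0 ≤ q ^ s := by positivity
  nlinarith

lemma flagCount_add_mul_le {q : ℚ} (hq : 2 ≤ q) {w K s : ℕ} (hw : K ≤ w) (j : ℕ)
    (h : s + j ≤ K) :
    flagCount q w K (s + j) * (q ^ (w - K)) ^ j ≤ flagCount q w K s := by
  induction j with
  | zero => simp
  | succ j ih =>
    refine le_trans ?_ (ih (by omega))
    rw [pow_succ', ← mul_assoc]
    have hlt : s + j < K := by omega
    exact mul_le_mul_of_nonneg_right (flagCount_succ_mul_le hq hw hlt) (by positivity)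

lemma flagCount_mul_prod {q : ℚ} (hq : 2 ≤ q) (w K : ℕ) :
    flagCount q w K 0 * ∏ i ∈ Finset.range K, (q ^ K - q ^ i) =
      ∏ i ∈ Finset.range K, (q ^ w - q ^ i) := by
  simp only [flagCount, Nat.sub_zero, zero_add]
  rw [← Finset.prod_mul_distrib]
  refine Finset.prod_congr rfl fun i hi => div_mul_cancel₀ _ ?_
  have : q ^ i < q ^ K := pow_lt_pow_right₀ (by linarith) (Finset.mem_range.1 hi)
  linarith

lemma prod_pow_sub_pow_succ_le {q : ℚ} (hq : 2 ≤ q) {n T : ℕ} (hn : T ≤ n) :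
    ∏ i ∈ Finset.range T, (q ^ (n + 1) - q ^ i) ≤
      2 * q ^ T * ∏ i ∈ Finset.range T, (q ^ n - q ^ i) := by
  have key : (∏ i ∈ Finset.range T, (q ^ (n + 1) - q ^ i)) * (q ^ (n + 1) - q ^ T) =
      (q ^ T * ∏ i ∈ Finset.range T, (q ^ n - q ^ i)) * (q ^ (n + 1) - 1) := by
    rw [← Finset.prod_range_succ (fun i => q ^ (n + 1) - q ^ i), Finset.prod_range_succ']
    rw [pow_zero]
    congr 1
    rw [← Finset.card_range T, ← Finset.prod_const, Finset.card_range, ← Finset.prod_mul_distrib]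
    exact Finset.prod_congr rfl fun i _ => by ring
  have h0 : 0 ≤ ∏ i ∈ Finset.range T, (q ^ n - q ^ i) := Finset.prod_nonneg fun i hi => by
    have : q ^ i ≤ q ^ n :=
      pow_le_pow_right₀ (by linarith) (by have := Finset.mem_range.1 hi; omega)
    linarith
  have h1 : 0 ≤ q ^ T * ∏ i ∈ Finset.range T, (q ^ n - q ^ i) := mul_nonneg (by positivity) h0
  have h2 : q ^ T ≤ q ^ n := pow_le_pow_right₀ (by linarith) hn
  have h3 : 0 < q ^ n := by positivity
  have h4 : 2 * q ^ n ≤ q ^ (n + 1) := by rw [pow_succ]; nlinarith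
  refine le_of_mul_le_mul_right (a := q ^ (n + 1) - q ^ T) ?_ (by linarith)
  rw [key]
  nlinarith

lemma flagCount_zero_le {q : ℚ} (hq : 2 ≤ q) (T a : ℕ) :
    flagCount q (T + a) T 0 ≤ (2 * q ^ T) ^ a := by
  have hP : 0 < ∏ i ∈ Finset.range T, (q ^ T - q ^ i) := Finset.prod_pos fun i hi => by
    have : q ^ i < q ^ T := pow_lt_pow_right₀ (by linarith) (Finset.mem_range.1 hi)
    linarith
  refine le_of_mul_le_mul_right (a := ∏ i ∈ Finset.range T, (q ^ T - q ^ i)) ?_ hP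
  rw [flagCount_mul_prod hq]
  induction a with
  | zero => simp
  | succ a ih =>
    refine (prod_pow_sub_pow_succ_le hq (n := T + a) (by omega)).trans ?_
    rw [pow_succ', mul_assoc (2 * q ^ T)]
    exact mul_le_mul_of_nonneg_left ih (by positivity)

lemma pow_sub_one_div_lt {q : ℚ} (hq : 2 ≤ q) (m : ℕ) :
    (q ^ (m + 1) - 1) / (q - 1) < 2 * q ^ m := by
  rw [div_lt_iff₀ (by linarith), pow_succ]
  have : 0 < q ^ m := by positivity
  nlinarith

/-! ### Counting subspaces -/

section Linear

variable {F V : Type*} [Field F] [AddCommGroup V] [Module F V] [Finite V]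

/-- `S` meets every member of `G` in dimension at least `T`. -/
def Covers (T : ℕ) (S : Submodule F V) (G : Set (Submodule F V)) : Prop :=
  ∀ A ∈ G, T ≤ finrank F ↥(S ⊓ A)

lemma Covers.le {T : ℕ} {S : Submodule F V} {G : Set (Submodule F V)} (h : Covers T S G)
    (hS : finrank F S = T) {A : Submodule F V} (hA : A ∈ G) : S ≤ A :=
  inf_eq_left.1 (Submodule.eq_of_le_of_finrank_le inf_le_left (hS ▸ h A hA))

lemma exists_minimal_cover {G G' : Set (Submodule F V)} {K T : ℕ}
    (hG : ∀ A ∈ G, finrank F A = K) (hne : G.Nonempty) (hne' : G'.Nonempty)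
    (hc : ∀ A ∈ G, Covers T A G') :
    ∃ a, ∃ W : Submodule F V, T + a ≤ K ∧ finrank F W = T + a ∧ Covers T W G' ∧
      ∀ S : Submodule F V, finrank F S < T + a → ¬ Covers T S G' := by
  classical
  have hex : ∃ x, ∃ W : Submodule F V, finrank F W = x ∧ Covers T W G' := by
    obtain ⟨A, hA⟩ := hne
    exact ⟨_, A, rfl, hc A hA⟩
  obtain ⟨W, hW, hcov⟩ := Nat.find_spec hex
  have hT : T ≤ Nat.find hex := by
    obtain ⟨B, hB⟩ := hne'
    rw [← hW]
    exact (hcov B hB).trans (Submodule.finrank_mono inf_le_left)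
  obtain ⟨a, ha⟩ := Nat.exists_eq_add_of_le hT
  obtain ⟨A, hA⟩ := hne
  refine ⟨a, W, ?_, hW.trans ha, hcov, fun S hS hS' => Nat.find_min hex (ha ▸ hS) ⟨S, rfl, hS'⟩⟩
  rw [← ha]
  exact Nat.find_min' hex ⟨A, hG A hA, hc A hA⟩

/-- The subspaces of dimension `K` between `S` and `W`. -/
def grass (S W : Submodule F V) (K : ℕ) : Set (Submodule F V) :=
  {U | S ≤ U ∧ U ≤ W ∧ finrank F U = K}

variable [Fintype F]

lemma two_le_card (F : Type*) [Field F] [Fintype F] : (2 : ℚ) ≤ Fintype.card F := by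
  exact_mod_cast Fintype.one_lt_card

lemma ncard_submodule (U : Submodule F V) :
    (U : Set V).ncard = Fintype.card F ^ finrank F U := by
  rw [← Nat.card_eq_fintype_card, ← Module.natCard_eq_pow_finrank (K := F) (V := U)]
  rfl

lemma ncard_sdiff_submodule {S U : Submodule F V} (h : S ≤ U) :
    (((U : Set V) \ S).ncard : ℚ) =
      (Fintype.card F : ℚ) ^ finrank F U - (Fintype.card F : ℚ) ^ finrank F S := by
  have := Set.ncard_sdiff_add_ncard_of_subset (s := (S : Set V)) (t := U) h (Set.toFinite _)
  rw [ncard_submodule, ncard_submodule] at this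
  have h2 := congrArg (Nat.cast : ℕ → ℚ) this
  push_cast at h2
  linarith

open Classical in
lemma sum_ncard_comm {α β : Type*} [Finite α] [Finite β] (s : Set α) (t : Set β)
    (r : α → β → Prop) :
    ∑ a ∈ s.toFinite.toFinset, {b ∈ t | r a b}.ncard =
      ∑ b ∈ t.toFinite.toFinset, {a ∈ s | r a b}.ncard := by
  convert Finset.sum_card_bipartiteAbove_eq_sum_card_bipartiteBelow r
    (s := s.toFinite.toFinset) (t := t.toFinite.toFinset) using 2 with a _ b _
  · rw [Set.ncard_eq_toFinset_card _ (Set.toFinite _)]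
    congr 1; ext; simp [Finset.mem_bipartiteAbove]
  · rw [Set.ncard_eq_toFinset_card _ (Set.toFinite _)]
    congr 1; ext; simp [Finset.mem_bipartiteBelow]

lemma ncard_grass {S W : Submodule F V} (hSW : S ≤ W) {K : ℕ} (hK : finrank F S ≤ K) :
    ((grass S W K).ncard : ℚ) = flagCount (Fintype.card F) (finrank F W) K (finrank F S) := by
  obtain ⟨j, hj⟩ := Nat.exists_eq_add_of_le hK
  clear hK
  induction j generalizing S with
  | zero =>
    have : grass S W K = {S} := by
      ext U
      simp only [grass, Set.mem_ofPred_eq, Set.mem_singleton_iff]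
      constructor
      · rintro ⟨h1, -, h2⟩
        exact (Submodule.eq_of_le_of_finrank_eq h1 (by omega)).symm
      · rintro rfl
        exact ⟨le_rfl, hSW, by omega⟩
    rw [this, hj, Nat.add_zero, flagCount_self]
    simp
  | succ j ih =>
    have hlt : finrank F S < K := by omega
    have hq := two_le_card F
    have hpow : (Fintype.card F : ℚ) ^ finrank F S < (Fintype.card F : ℚ) ^ K :=
      pow_lt_pow_right₀ (by linarith) hlt
    have hcomm := sum_ncard_comm (grass S W K) ((W : Set V) \ S) (fun U v => v ∈ U)
    have hcomm := congrArg (Nat.cast : ℕ → ℚ) hcomm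
    push_cast at hcomm
    rw [Finset.sum_congr rfl (g := fun _ =>
        (Fintype.card F : ℚ) ^ K - (Fintype.card F : ℚ) ^ finrank F S),
      Finset.sum_congr (s₁ := ((W : Set V) \ S).toFinite.toFinset) rfl (g := fun _ =>
        flagCount (Fintype.card F) (finrank F W) K (finrank F S + 1))] at hcomm
    · rw [Finset.sum_const, Finset.sum_const, nsmul_eq_mul, nsmul_eq_mul,
        ← Set.ncard_eq_toFinset_card, ← Set.ncard_eq_toFinset_card,
        ncard_sdiff_submodule hSW] at hcomm
      rw [flagCount_succ _ hlt, div_mul_eq_mul_div, eq_div_iff (by linarith)]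
      exact hcomm
    · intro v hv
      simp only [Set.Finite.mem_toFinset, Set.mem_sdiff, SetLike.mem_coe] at hv
      have hfin := Submodule.finrank_sup_span_singleton (K := F) hv.2
      rw [← hfin, ← ih (S := S ⊔ F ∙ v) _ (by omega)]
      · congr 2
        ext U
        simp only [grass, Set.mem_ofPred_eq, sup_le_iff, Submodule.span_singleton_le_iff_mem]
        tauto
      · simp [hSW, Submodule.span_singleton_le_iff_mem, hv.1]
    · intro U hU
      simp only [Set.Finite.mem_toFinset, grass, Set.mem_ofPred_eq] at hU
      rw [← hU.2.2, ← ncard_sdiff_submodule hU.1]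
      congr 2
      ext v
      simp only [Set.mem_ofPred_eq, Set.mem_sdiff, SetLike.mem_coe]
      constructor
      · tauto
      · exact fun h => ⟨⟨hU.2.1 h.1, h.2⟩, h.1⟩

lemma grass_nonempty {S W : Submodule F V} (hSW : S ≤ W) {K : ℕ} (hK : finrank F S ≤ K)
    (hK' : K ≤ finrank F W) : (grass S W K).Nonempty := by
  rw [← Set.ncard_pos]
  have := flagCount_pos (two_le_card F) hK' (finrank F S)
  rw [← ncard_grass hSW hK] at this
  exact_mod_cast this

/-! ### Cross-intersecting families of subspaces -/

lemma exists_le_disjoint {B R : Submodule F V} (hR : R ≤ B) {m : ℕ}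
    (hm : m + finrank F R ≤ finrank F B) :
    ∃ C ≤ B, finrank F C = m ∧ Disjoint R C := by
  obtain ⟨D, hD⟩ := Submodule.exists_isCompl R
  have hsup : R ⊔ D ⊓ B = B := by
    rw [← sup_inf_assoc_of_le D hR, hD.sup_eq_top, top_inf_eq]
  have hinf : R ⊓ (D ⊓ B) = ⊥ := by
    rw [← inf_assoc, hD.inf_eq_bot, bot_inf_eq]
  have := Submodule.finrank_sup_add_finrank_inf_eq R (D ⊓ B)
  rw [hsup, hinf, finrank_bot] at this
  obtain ⟨C, -, hC, hCm⟩ := grass_nonempty (bot_le : ⊥ ≤ D ⊓ B) (K := m) (by simp) (by omega)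
  exact ⟨C, hC.trans inf_le_right, hCm, (disjoint_iff.2 hinf).mono_right hC⟩

/-- If `S` meets a member `B` of the other family in dimension less than `T`, every member of `G`
through `S` contains one of few subspaces through `S` of dimension one more. -/
lemma ncard_through_le {G : Set (Submodule F V)} {B S : Submodule F V} {m T : ℕ}
    (hB : finrank F B = T + m) (hG : ∀ A ∈ G, T ≤ finrank F ↥(A ⊓ B))
    (hS : finrank F ↥(S ⊓ B) < T) {M : ℚ}
    (hM : ∀ S' : Submodule F V, finrank F S' = finrank F S + 1 →
      ({A ∈ G | S' ≤ A}.ncard : ℚ) ≤ M) :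
    ({A ∈ G | S ≤ A}.ncard : ℚ) ≤
      ((Fintype.card F : ℚ) ^ (m + 1) - 1) / ((Fintype.card F : ℚ) - 1) * M := by
  have hq := two_le_card F
  obtain ⟨C, hCB, hC, hdisj⟩ := exists_le_disjoint (R := S ⊓ B) (B := B) inf_le_right
    (m := m + 1) (by omega)
  have hcomm := sum_ncard_comm {A ∈ G | S ≤ A} ((C : Set V) \ (⊥ : Submodule F V))
    (fun A v => v ∈ A)
  have hcomm := congrArg (Nat.cast : ℕ → ℚ) hcomm
  push_cast at hcomm
  have hlow : ∀ A ∈ {A ∈ G | S ≤ A}.toFinite.toFinset, (Fintype.card F : ℚ) - 1 ≤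
      ({v ∈ (C : Set V) \ (⊥ : Submodule F V) | v ∈ A}.ncard : ℚ) := by
    intro A hA
    simp only [Set.Finite.mem_toFinset, Set.mem_ofPred_eq] at hA
    have hsub : {v ∈ (C : Set V) \ (⊥ : Submodule F V) | v ∈ A} =
        ((A ⊓ C : Submodule F V) : Set V) \ (⊥ : Submodule F V) := by
      ext v
      simp only [Set.mem_ofPred_eq, Set.mem_sdiff, SetLike.mem_coe, Submodule.mem_inf]
      tauto
    rw [hsub, ncard_sdiff_submodule bot_le, finrank_bot, pow_zero]
    have h1 := Submodule.finrank_sup_add_finrank_inf_eq (A ⊓ B) C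
    have h2 := Submodule.finrank_mono (R := F) (sup_le (inf_le_right : A ⊓ B ≤ B) hCB)
    rw [inf_assoc, inf_eq_right.2 hCB] at h1
    have h3 := hG A hA.1
    have h4 : (Fintype.card F : ℚ) ^ 1 ≤ (Fintype.card F : ℚ) ^ finrank F ↥(A ⊓ C) :=
      pow_le_pow_right₀ (by linarith) (by omega)
    linarith
  have hupp : ∀ v ∈ ((C : Set V) \ (⊥ : Submodule F V)).toFinite.toFinset,
      ({A ∈ {A ∈ G | S ≤ A} | v ∈ A}.ncard : ℚ) ≤ M := by
    intro v hv
    simp only [Set.Finite.mem_toFinset, Set.mem_sdiff, SetLike.mem_coe, Submodule.mem_bot] at hv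
    have hvS : v ∉ S := fun h =>
      hv.2 (Submodule.disjoint_def.1 hdisj v ⟨h, hCB hv.1⟩ hv.1)
    convert hM (S ⊔ F ∙ v) (Submodule.finrank_sup_span_singleton hvS) using 3
    ext A
    simp only [Set.mem_ofPred_eq, sup_le_iff, Submodule.span_singleton_le_iff_mem]
    tauto
  have h1 := Finset.card_nsmul_le_sum _ _ _ hlow
  have h2 := Finset.sum_le_card_nsmul _ _ _ hupp
  rw [nsmul_eq_mul, ← Set.ncard_eq_toFinset_card] at h1 h2
  rw [ncard_sdiff_submodule bot_le, hC, finrank_bot, pow_zero] at h2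
  rw [div_mul_eq_mul_div, le_div_iff₀ (by linarith)]
  linarith

lemma ncard_through_le_flagCount {G : Set (Submodule F V)} {K : ℕ}
    (hG : ∀ A ∈ G, finrank F A = K) (S : Submodule F V) (hS : finrank F S ≤ K) :
    ({A ∈ G | S ≤ A}.ncard : ℚ) ≤ flagCount (Fintype.card F) (finrank F V) K (finrank F S) := by
  rw [← finrank_top F V, ← ncard_grass le_top hS]
  have hsub : {A ∈ G | S ≤ A} ⊆ grass S ⊤ K := fun A hA => ⟨hA.2, le_top, hG A hA.1⟩
  exact_mod_cast Set.ncard_le_ncard hsub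

lemma ncard_through_le_pow {G₁ G₂ : Set (Submodule F V)} {K₁ T b m : ℕ}
    (h₁ : ∀ A ∈ G₁, finrank F A = K₁) (h₂ : ∀ B ∈ G₂, finrank F B = T + m)
    (hc : ∀ A ∈ G₁, Covers T A G₂) (hb : T + b ≤ K₁)
    (hmin : ∀ S : Submodule F V, finrank F S < T + b → ¬ Covers T S G₂)
    (j : ℕ) (S : Submodule F V) (hS : finrank F S + j = T + b) :
    ({A ∈ G₁ | S ≤ A}.ncard : ℚ) ≤
      (((Fintype.card F : ℚ) ^ (m + 1) - 1) / ((Fintype.card F : ℚ) - 1)) ^ j *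
        flagCount (Fintype.card F) (finrank F V) K₁ (T + b) := by
  induction j generalizing S with
  | zero =>
    rw [pow_zero, one_mul, ← hS]
    exact ncard_through_le_flagCount h₁ S (by omega)
  | succ j ih =>
    have := hmin S (by omega)
    simp only [Covers, not_forall, not_le] at this
    obtain ⟨B, hB, hlt⟩ := this
    rw [pow_succ', mul_assoc]
    exact ncard_through_le (h₂ B hB) (fun A hA => hc A hA B hB) hlt
      (fun S' hS' => ih S' (by omega))

lemma ncard_le_mul_of_covers {G : Set (Submodule F V)} {T a : ℕ} {W : Submodule F V}
    (hW : finrank F W = T + a) (hcov : Covers T W G) {M : ℚ}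
    (hM : ∀ S : Submodule F V, finrank F S = T → ({A ∈ G | S ≤ A}.ncard : ℚ) ≤ M) :
    (G.ncard : ℚ) ≤ flagCount (Fintype.card F) (T + a) T 0 * M := by
  have hcomm := sum_ncard_comm G (grass ⊥ W T) (fun A L => L ≤ A)
  have hcomm := congrArg (Nat.cast : ℕ → ℚ) hcomm
  push_cast at hcomm
  have hlow : ∀ A ∈ G.toFinite.toFinset, (1 : ℚ) ≤ ({L ∈ grass ⊥ W T | L ≤ A}.ncard : ℚ) := by
    intro A hA
    rw [Set.Finite.mem_toFinset] at hA
    obtain ⟨L, -, hL, hLT⟩ := grass_nonempty (bot_le : ⊥ ≤ W ⊓ A) (by simp) (hcov A hA)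
    have : 0 < {L ∈ grass ⊥ W T | L ≤ A}.ncard := (Set.ncard_pos (Set.toFinite _)).2
      ⟨L, ⟨bot_le, hL.trans inf_le_left, hLT⟩, hL.trans inf_le_right⟩
    exact_mod_cast this
  have hupp : ∀ L ∈ (grass ⊥ W T).toFinite.toFinset, ({A ∈ G | L ≤ A}.ncard : ℚ) ≤ M := by
    intro L hL
    rw [Set.Finite.mem_toFinset] at hL
    exact hM L hL.2.2
  have h1 := Finset.card_nsmul_le_sum _ _ _ hlow
  have h2 := Finset.sum_le_card_nsmul _ _ _ hupp
  rw [nsmul_eq_mul, ← Set.ncard_eq_toFinset_card] at h1 h2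
  rw [ncard_grass bot_le (by simp), finrank_bot, hW] at h2
  linarith

lemma ncard_le_of_covers {G₁ G₂ : Set (Submodule F V)} {K₁ T a b m : ℕ} {W : Submodule F V}
    (h₁ : ∀ A ∈ G₁, finrank F A = K₁) (h₂ : ∀ B ∈ G₂, finrank F B = T + m)
    (hc : ∀ A ∈ G₁, Covers T A G₂) (hb : T + b ≤ K₁)
    (hmin : ∀ S : Submodule F V, finrank F S < T + b → ¬ Covers T S G₂)
    (hW : finrank F W = T + a) (hcov : Covers T W G₁) :
    (G₁.ncard : ℚ) ≤ (2 * (Fintype.card F : ℚ) ^ T) ^ a *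
      ((((Fintype.card F : ℚ) ^ (m + 1) - 1) / ((Fintype.card F : ℚ) - 1)) ^ b *
        flagCount (Fintype.card F) (finrank F V) K₁ (T + b)) := by
  have h := ncard_le_mul_of_covers hW hcov fun S hS =>
    ncard_through_le_pow h₁ h₂ hc hb hmin b S (by omega)
  refine h.trans (mul_le_mul_of_nonneg_right (flagCount_zero_le (two_le_card F) T a) ?_)
  obtain ⟨L, -, -, hL⟩ := grass_nonempty (bot_le : ⊥ ≤ W) (K := T) (by simp) (by omega)
  exact (Nat.cast_nonneg _).trans
    (ncard_through_le_pow h₁ h₂ hc hb hmin b (S := L) (by omega))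

lemma ncard_mul_pow_lt {G₁ G₂ : Set (Submodule F V)} {K₁ T a b m : ℕ} {W : Submodule F V}
    (h₁ : ∀ A ∈ G₁, finrank F A = K₁) (h₂ : ∀ B ∈ G₂, finrank F B = T + m)
    (hN : K₁ + (T + m) + 2 ≤ finrank F V)
    (hc : ∀ A ∈ G₁, Covers T A G₂) (hb : T + b ≤ K₁)
    (hmin : ∀ S : Submodule F V, finrank F S < T + b → ¬ Covers T S G₂)
    (hW : finrank F W = T + a) (hcov : Covers T W G₁) (hb0 : b ≠ 0) :
    (G₁.ncard : ℚ) * (2 * (Fintype.card F : ℚ) ^ T) ^ b <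
      (2 * (Fintype.card F : ℚ) ^ T) ^ a * flagCount (Fintype.card F) (finrank F V) K₁ T := by
  have h := ncard_le_of_covers h₁ h₂ hc hb hmin hW hcov
  have hq := two_le_card F
  have hKN : K₁ ≤ finrank F V := by omega
  have hr := pow_sub_one_div_lt hq m
  have hflag := flagCount_add_mul_le hq hKN b hb
  have hflag0 := flagCount_pos hq hKN T
  have hflagb := flagCount_pos hq hKN (T + b)
  generalize flagCount (Fintype.card F : ℚ) (finrank F V) K₁ T = γ at *
  generalize flagCount (Fintype.card F : ℚ) (finrank F V) K₁ (T + b) = γ' at *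
  generalize (Fintype.card F : ℚ) = Q at *
  have hr0 : 0 ≤ (Q ^ (m + 1) - 1) / (Q - 1) :=
    div_nonneg (by linarith [one_le_pow₀ (show 1 ≤ Q by linarith) (n := m + 1)]) (by linarith)
  generalize (Q ^ (m + 1) - 1) / (Q - 1) = r at *
  have hD : (2 * Q ^ T) * (2 * Q ^ m) ≤ Q ^ (finrank F V - K₁) :=
    calc (2 * Q ^ T) * (2 * Q ^ m) = 2 ^ 2 * Q ^ (T + m) := by ring
      _ ≤ Q ^ 2 * Q ^ (T + m) := by gcongr
      _ = Q ^ (T + m + 2) := by ring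
      _ ≤ Q ^ (finrank F V - K₁) := pow_le_pow_right₀ (by linarith) (by omega)
  have hX : 0 < 2 * Q ^ T := by positivity
  have hY : 0 < 2 * Q ^ m := by positivity
  generalize 2 * Q ^ T = X at *
  generalize 2 * Q ^ m = Y at *
  refine lt_of_mul_lt_mul_right (a := Y ^ b) ?_ (by positivity)
  calc (G₁.ncard : ℚ) * X ^ b * Y ^ b = G₁.ncard * (X * Y) ^ b := by rw [mul_pow]; ring
    _ ≤ X ^ a * (r ^ b * γ') * (Q ^ (finrank F V - K₁)) ^ b := by gcongr
    _ = X ^ a * r ^ b * (γ' * (Q ^ (finrank F V - K₁)) ^ b) := by ring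
    _ ≤ X ^ a * r ^ b * γ := by gcongr
    _ < X ^ a * Y ^ b * γ := by gcongr
    _ = X ^ a * γ * Y ^ b := by ring

lemma ncard_mul_pow_le {G₁ G₂ : Set (Submodule F V)} {K₁ T a b m : ℕ} {W : Submodule F V}
    (h₁ : ∀ A ∈ G₁, finrank F A = K₁) (h₂ : ∀ B ∈ G₂, finrank F B = T + m)
    (hN : K₁ + (T + m) + 2 ≤ finrank F V)
    (hc : ∀ A ∈ G₁, Covers T A G₂) (hb : T + b ≤ K₁)
    (hmin : ∀ S : Submodule F V, finrank F S < T + b → ¬ Covers T S G₂)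
    (hW : finrank F W = T + a) (hcov : Covers T W G₁) :
    (G₁.ncard : ℚ) * (2 * (Fintype.card F : ℚ) ^ T) ^ b ≤
      (2 * (Fintype.card F : ℚ) ^ T) ^ a * flagCount (Fintype.card F) (finrank F V) K₁ T := by
  rcases eq_or_ne b 0 with rfl | hb0
  · simpa using ncard_le_of_covers h₁ h₂ hc hb hmin hW hcov
  · exact (ncard_mul_pow_lt h₁ h₂ hN hc hb hmin hW hcov hb0).le

/-- If all of `G₁` passes through a `T`-space not covering `G₂`, then `G₁` is not extremal. -/
lemma ncard_lt_of_not_covers {G₁ G₂ : Set (Submodule F V)} {K₁ T m : ℕ} {S : Submodule F V}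
    (h₁ : ∀ A ∈ G₁, finrank F A = K₁) (h₂ : ∀ B ∈ G₂, finrank F B = T + m)
    (hN : K₁ + (T + m) + 2 ≤ finrank F V) (hne : G₁.Nonempty)
    (hc : ∀ A ∈ G₁, Covers T A G₂) (hS : finrank F S = T) (hcov : Covers T S G₁)
    (hnot : ¬ Covers T S G₂) :
    (G₁.ncard : ℚ) < flagCount (Fintype.card F) (finrank F V) K₁ T := by
  have hSA : ∀ A ∈ G₁, S ≤ A := fun A hA => hcov.le hS hA
  have hlt : T < K₁ := by
    obtain ⟨A, hA⟩ := hne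
    have hle := Submodule.finrank_mono (hSA A hA)
    rw [hS, h₁ A hA] at hle
    refine lt_of_le_of_ne hle fun heq => hnot ?_
    rw [Submodule.eq_of_le_of_finrank_eq (hSA A hA) (by rw [hS, h₁ A hA, heq])]
    exact hc A hA
  simp only [Covers, not_forall, not_le] at hnot
  obtain ⟨B, hB, hSB⟩ := hnot
  have h := ncard_through_le (h₂ B hB) (fun A hA => hc A hA B hB) hSB
    (M := flagCount (Fintype.card F) (finrank F V) K₁ (T + 1)) fun S' hS' => by
      rw [hS] at hS'
      rw [← hS']
      exact ncard_through_le_flagCount h₁ S' (by omega)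
  rw [Set.sep_eq_self_iff_mem_true.2 hSA] at h
  have hq := two_le_card F
  have hKN : K₁ ≤ finrank F V := by omega
  have hr := pow_sub_one_div_lt hq m
  have hflag := flagCount_succ_mul_le hq hKN hlt
  have hflag1 := flagCount_pos hq hKN (T + 1)
  refine (h.trans_lt (mul_lt_mul_of_pos_right hr hflag1)).trans_le (le_trans ?_ hflag)
  rw [mul_comm]
  refine mul_le_mul_of_nonneg_left ?_ hflag1.le
  calc 2 * (Fintype.card F : ℚ) ^ m ≤ Fintype.card F * (Fintype.card F : ℚ) ^ m := by gcongr
    _ = (Fintype.card F : ℚ) ^ (m + 1) := by ring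
    _ ≤ (Fintype.card F : ℚ) ^ (finrank F V - K₁) := pow_le_pow_right₀ (by linarith) (by omega)

/-- Cross `T`-intersecting families of subspaces whose product of sizes reaches the trivial bound
pass through a common `T`-dimensional subspace. -/
theorem exists_common_subspace {G₁ G₂ : Set (Submodule F V)} {K₁ K₂ T : ℕ}
    (h₁ : ∀ A ∈ G₁, finrank F A = K₁) (h₂ : ∀ B ∈ G₂, finrank F B = K₂)
    (hT₁ : T ≤ K₁) (hT₂ : T ≤ K₂) (hN : K₁ + K₂ + 2 ≤ finrank F V)
    (hc : ∀ A ∈ G₁, ∀ B ∈ G₂, T ≤ finrank F ↥(A ⊓ B))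
    (hbig : flagCount (Fintype.card F) (finrank F V) K₁ T *
      flagCount (Fintype.card F) (finrank F V) K₂ T ≤ (G₁.ncard : ℚ) * G₂.ncard) :
    ∃ S : Submodule F V, finrank F S = T ∧ (∀ A ∈ G₁, S ≤ A) ∧ ∀ B ∈ G₂, S ≤ B := by
  have hq := two_le_card F
  have hγ₁ := flagCount_pos hq (show K₁ ≤ finrank F V by omega) T
  have hγ₂ := flagCount_pos hq (show K₂ ≤ finrank F V by omega) T
  have hpos : (0 : ℚ) < (G₁.ncard : ℚ) * G₂.ncard := (mul_pos hγ₁ hγ₂).trans_le hbig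
  have hne₁ : G₁.Nonempty := Set.nonempty_iff_ne_empty.2 fun h => by simp [h] at hpos
  have hne₂ : G₂.Nonempty := Set.nonempty_iff_ne_empty.2 fun h => by simp [h] at hpos
  have hc₁ : ∀ A ∈ G₁, Covers T A G₂ := hc
  have hc₂ : ∀ B ∈ G₂, Covers T B G₁ := fun B hB A hA => inf_comm A B ▸ hc A hA B hB
  obtain ⟨a, W₁, haK, hW₁, hcov₁, hmin₁⟩ := exists_minimal_cover h₂ hne₂ hne₁ hc₂
  obtain ⟨b, W₂, hbK, hW₂, hcov₂, hmin₂⟩ := exists_minimal_cover h₁ hne₁ hne₂ hc₁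
  obtain ⟨m₁, rfl⟩ := Nat.exists_eq_add_of_le hT₁
  obtain ⟨m₂, rfl⟩ := Nat.exists_eq_add_of_le hT₂
  have le₁ := ncard_mul_pow_le h₁ h₂ hN hc₁ hbK hmin₂ hW₁ hcov₁
  have le₂ := ncard_mul_pow_le h₂ h₁ (by omega) hc₂ haK hmin₁ hW₂ hcov₂
  have lt₁ := ncard_mul_pow_lt h₁ h₂ hN hc₁ hbK hmin₂ hW₁ hcov₁
  have lt₂ := ncard_mul_pow_lt h₂ h₁ (by omega) hc₂ haK hmin₁ hW₂ hcov₂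
  have hX : 0 < 2 * (Fintype.card F : ℚ) ^ T := by positivity
  have hn₁ : (0 : ℚ) < G₁.ncard := pos_of_mul_pos_left hpos (Nat.cast_nonneg _)
  have hn₂ : (0 : ℚ) < G₂.ncard := pos_of_mul_pos_right hpos (Nat.cast_nonneg _)
  by_cases hab : a = 0 ∧ b = 0
  · obtain ⟨rfl, rfl⟩ := hab
    by_cases hcov : Covers T W₁ G₂
    · exact ⟨W₁, hW₁, fun A hA => hcov₁.le hW₁ hA, fun B hB => hcov.le hW₁ hB⟩
    · have lt := ncard_lt_of_not_covers h₁ h₂ hN hne₁ hc₁ hW₁ hcov₁ hcov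
      simp only [pow_zero, mul_one, one_mul] at le₂
      exact absurd hbig (not_le.2 (mul_lt_mul lt le₂ hn₂ hγ₁.le))
  · exfalso
    generalize flagCount (Fintype.card F : ℚ) (finrank F V) (T + m₁) T = γ₁ at *
    generalize flagCount (Fintype.card F : ℚ) (finrank F V) (T + m₂) T = γ₂ at *
    generalize 2 * (Fintype.card F : ℚ) ^ T = X at *
    have key : (G₁.ncard * X ^ b) * (G₂.ncard * X ^ a) < (X ^ a * γ₁) * (X ^ b * γ₂) := by
      by_cases hb : b = 0
      · exact mul_lt_mul' le₁ (lt₂ fun ha => hab ⟨ha, hb⟩) (by positivity) (by positivity)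
      · exact mul_lt_mul (lt₁ hb) le₂ (by positivity) (by positivity)
    have : (G₁.ncard : ℚ) * G₂.ncard < γ₁ * γ₂ := by
      refine lt_of_mul_lt_mul_right (a := X ^ a * X ^ b) ?_ (by positivity)
      calc _ = (G₁.ncard * X ^ b) * (G₂.ncard * X ^ a) := by ring
        _ < _ := key
        _ = _ := by ring
    linarith

end Linear

/-! ### Flats as hyperplane sections of subspaces -/

section Affine

variable {𝔽 : Type} [Field 𝔽] {n : ℕ}

/-- The flat cut out by a subspace on the affine hyperplane at height one. -/
def slice (U : Submodule 𝔽 ((Fin n → 𝔽) × 𝔽)) : Set (Fin n → 𝔽) := {v | (v, 1) ∈ U}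

lemma mem_slice {U : Submodule 𝔽 ((Fin n → 𝔽) × 𝔽)} {v : Fin n → 𝔽} :
    v ∈ slice U ↔ (v, 1) ∈ U := Iff.rfl

lemma slice_inf (U U' : Submodule 𝔽 ((Fin n → 𝔽) × 𝔽)) :
    slice (U ⊓ U') = slice U ∩ slice U' := rfl

lemma slice_mono {U U' : Submodule 𝔽 ((Fin n → 𝔽) × 𝔽)} (h : U ≤ U') : slice U ⊆ slice U' :=
  fun _ hv => h hv

lemma le_of_slice_subset {U U' : Submodule 𝔽 ((Fin n → 𝔽) × 𝔽)} (hne : (slice U).Nonempty)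
    (h : slice U ⊆ slice U') : U ≤ U' := by
  obtain ⟨x, hx⟩ := hne
  have key : ∀ p : Fin n → 𝔽, (p, (0 : 𝔽)) ∈ U → (p, (0 : 𝔽)) ∈ U' := fun p hp => by
    have h1 : p + x ∈ slice U := by simpa [mem_slice] using U.add_mem hp hx
    simpa using U'.sub_mem (h h1) (h hx)
  rintro ⟨v, c⟩ hv
  have h1 : (v - c • x, (0 : 𝔽)) ∈ U := by simpa using U.sub_mem hv (U.smul_mem c hx)
  simpa using U'.add_mem (key _ h1) (U'.smul_mem c (h hx))

lemma slice_inj {U U' : Submodule 𝔽 ((Fin n → 𝔽) × 𝔽)} (hne : (slice U).Nonempty)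
    (h : slice U = slice U') : U = U' :=
  le_antisymm (le_of_slice_subset hne h.subset) (le_of_slice_subset (h ▸ hne) h.symm.subset)

/-- The subspace spanned by the flat `x + P` placed at height one. -/
def coneOver (P : Submodule 𝔽 (Fin n → 𝔽)) (x : Fin n → 𝔽) :
    Submodule 𝔽 ((Fin n → 𝔽) × 𝔽) :=
  P.map (LinearMap.inl 𝔽 _ _) ⊔ 𝔽 ∙ (x, 1)

lemma finrank_coneOver (P : Submodule 𝔽 (Fin n → 𝔽)) (x : Fin n → 𝔽) :
    finrank 𝔽 (coneOver P x) = finrank 𝔽 P + 1 := by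
  rw [coneOver, Submodule.finrank_sup_span_singleton (by simp),
    (Submodule.equivMapOfInjective _ LinearMap.inl_injective P).symm.finrank_eq]

lemma slice_coneOver (P : Submodule 𝔽 (Fin n → 𝔽)) (x : Fin n → 𝔽) :
    slice (coneOver P x) = {v | v - x ∈ P} := by
  ext v
  simp only [mem_slice, coneOver, Submodule.mem_sup, Submodule.mem_map,
    Submodule.mem_span_singleton, Set.mem_ofPred_eq]
  constructor
  · rintro ⟨_, ⟨p, hp, rfl⟩, _, ⟨c, rfl⟩, h⟩
    simp only [LinearMap.inl_apply, Prod.smul_mk, Prod.mk_add_mk, Prod.mk.injEq, smul_eq_mul,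
      mul_one, zero_add] at h
    obtain ⟨rfl, rfl⟩ := h
    simpa using hp
  · intro h
    exact ⟨_, ⟨v - x, h, rfl⟩, _, ⟨1, rfl⟩, by simp⟩

lemma isFlat_iff {k : ℕ} {A : Set (Fin n → 𝔽)} :
    IsFlat 𝔽 k A ↔ ∃ U : Submodule 𝔽 ((Fin n → 𝔽) × 𝔽),
      finrank 𝔽 U = k + 1 ∧ (slice U).Nonempty ∧ slice U = A := by
  constructor
  · rintro ⟨P, x, hP, rfl⟩
    refine ⟨coneOver P x, by rw [finrank_coneOver, hP], ?_, slice_coneOver P x⟩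
    rw [slice_coneOver]
    exact ⟨x, by simp⟩
  · rintro ⟨U, hU, ⟨x, hx⟩, rfl⟩
    have hs : slice U = slice (coneOver (U.comap (LinearMap.inl 𝔽 _ _)) x) := by
      rw [slice_coneOver]
      ext v
      simp only [mem_slice, Submodule.mem_comap, LinearMap.inl_apply, Set.mem_ofPred_eq]
      constructor
      · intro h
        simpa using U.sub_mem h hx
      · intro h
        simpa using U.add_mem h hx
    refine ⟨U.comap (LinearMap.inl 𝔽 _ _), x, ?_, hs.trans (slice_coneOver _ _)⟩
    have := finrank_coneOver (U.comap (LinearMap.inl 𝔽 _ _)) x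
    rw [← slice_inj ⟨x, hx⟩ hs, hU] at this
    omega

lemma isFlat_slice {k : ℕ} {U : Submodule 𝔽 ((Fin n → 𝔽) × 𝔽)} (hU : finrank 𝔽 U = k + 1)
    (hne : (slice U).Nonempty) : IsFlat 𝔽 k (slice U) :=
  isFlat_iff.2 ⟨U, hU, hne, rfl⟩

lemma IsFlat.nonempty {k : ℕ} {A : Set (Fin n → 𝔽)} (h : IsFlat 𝔽 k A) : A.Nonempty := by
  obtain ⟨U, -, hne, rfl⟩ := isFlat_iff.1 h
  exact hne

lemma dimGe_slice_iff {t : ℕ} {U : Submodule 𝔽 ((Fin n → 𝔽) × 𝔽)} :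
    DimGe 𝔽 t (slice U) ↔ (slice U).Nonempty ∧ t + 1 ≤ finrank 𝔽 U := by
  constructor
  · rintro ⟨j, hj, h⟩
    obtain ⟨Z, hZ, hne, hZU⟩ := isFlat_iff.1 h
    have hZU' := slice_inj hne hZU
    subst hZU'
    exact ⟨hne, by omega⟩
  · rintro ⟨hne, h⟩
    exact ⟨finrank 𝔽 U - 1, by omega, isFlat_slice (by omega) hne⟩

/-- The `(k + 1)`-dimensional subspaces spanned by the members of a family of `k`-flats. -/
def spanFamily (k : ℕ) (G : Set (Set (Fin n → 𝔽))) : Set (Submodule 𝔽 ((Fin n → 𝔽) × 𝔽)) :=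
  {U | finrank 𝔽 U = k + 1 ∧ slice U ∈ G}

variable {k : ℕ} {G : Set (Set (Fin n → 𝔽))}

lemma slice_nonempty_of_mem_spanFamily (hG : ∀ A ∈ G, IsFlat 𝔽 k A)
    {U : Submodule 𝔽 ((Fin n → 𝔽) × 𝔽)} (hU : U ∈ spanFamily k G) : (slice U).Nonempty :=
  (hG _ hU.2).nonempty

lemma exists_mem_spanFamily (hG : ∀ A ∈ G, IsFlat 𝔽 k A) {A : Set (Fin n → 𝔽)} (hA : A ∈ G) :
    ∃ U ∈ spanFamily k G, slice U = A := by
  obtain ⟨U, hU, -, rfl⟩ := isFlat_iff.1 (hG A hA)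
  exact ⟨U, ⟨hU, hA⟩, rfl⟩

lemma ncard_spanFamily (hG : ∀ A ∈ G, IsFlat 𝔽 k A) : (spanFamily k G).ncard = G.ncard := by
  have himg : slice '' spanFamily k G = G := by
    ext A
    constructor
    · rintro ⟨U, hU, rfl⟩
      exact hU.2
    · exact fun hA => exists_mem_spanFamily hG hA
  conv_rhs => rw [← himg]
  have hinj : Set.InjOn slice (spanFamily k G) := fun U hU U' _ h =>
    slice_inj (slice_nonempty_of_mem_spanFamily hG hU) h
  exact hinj.ncard_image.symm

lemma ncard_flats_through [Fintype 𝔽] {t : ℕ} {S : Submodule 𝔽 ((Fin n → 𝔽) × 𝔽)}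
    (hS : finrank 𝔽 S = t + 1) (hne : (slice S).Nonempty) (hk : t ≤ k) :
    ((A3 𝔽 (slice S) k).ncard : ℚ) = flagCount (Fintype.card 𝔽) (n + 1) (k + 1) (t + 1) := by
  have hV : finrank 𝔽 ((Fin n → 𝔽) × 𝔽) = n + 1 := by simp
  have hspan : spanFamily k (A3 𝔽 (slice S) k) = grass S ⊤ (k + 1) := by
    ext U
    constructor
    · rintro ⟨h1, -, h2⟩
      exact ⟨le_of_slice_subset hne h2, le_top, h1⟩
    · rintro ⟨h1, -, h2⟩
      exact ⟨h2, isFlat_slice h2 (hne.mono (slice_mono h1)), slice_mono h1⟩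
  rw [← ncard_spanFamily (k := k) (fun A hA => hA.1), hspan, ncard_grass le_top (by omega),
    finrank_top, hV, hS]

lemma ncard_spanFamily_lt [Fintype 𝔽] {t : ℕ} (hG : ∀ A ∈ G, IsFlat 𝔽 k A)
    {S : Submodule 𝔽 ((Fin n → 𝔽) × 𝔽)} (hS : finrank 𝔽 S = t + 1) (hemp : slice S = ∅)
    (hSG : ∀ U ∈ spanFamily k G, S ≤ U) (ht : t ≤ k) (hk : k + 1 ≤ n) :
    ((spanFamily k G).ncard : ℚ) < flagCount (Fintype.card 𝔽) (n + 1) (k + 1) (t + 1) := by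
  have hV : finrank 𝔽 ((Fin n → 𝔽) × 𝔽) = n + 1 := by simp
  have hker : finrank 𝔽 (LinearMap.ker (LinearMap.snd 𝔽 (Fin n → 𝔽) 𝔽)) = n := by
    have := LinearMap.finrank_range_add_finrank_ker (LinearMap.snd 𝔽 (Fin n → 𝔽) 𝔽)
    rw [LinearMap.range_eq_top.2 LinearMap.snd_surjective, finrank_top, hV, finrank_self] at this
    omega
  have hSH : S ≤ LinearMap.ker (LinearMap.snd 𝔽 (Fin n → 𝔽) 𝔽) := by
    rintro ⟨v, c⟩ hv
    by_contra hc
    rw [LinearMap.mem_ker, LinearMap.snd_apply] at hc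
    have : c⁻¹ • v ∈ slice S := by
      simpa [mem_slice, inv_mul_cancel₀ hc] using S.smul_mem c⁻¹ hv
    simp [hemp] at this
  obtain ⟨U, hSU, hUH, hU⟩ := grass_nonempty hSH (K := k + 1) (by omega) (by omega)
  rw [← hV, ← hS, ← finrank_top 𝔽 ((Fin n → 𝔽) × 𝔽), ← ncard_grass le_top (by omega)]
  have hnot : U ∉ spanFamily k G := fun h => by
    obtain ⟨x, hx⟩ := slice_nonempty_of_mem_spanFamily hG h
    simpa using hUH hx
  have hsub : spanFamily k G ⊆ grass S ⊤ (k + 1) := fun U' hU' => ⟨hSG U' hU', le_top, hU'.1⟩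
  have hmem : U ∈ grass S ⊤ (k + 1) := ⟨hSU, le_top, hU⟩
  have hss : spanFamily k G ⊂ grass S ⊤ (k + 1) := ⟨hsub, fun h => hnot (h hmem)⟩
  exact_mod_cast Set.ncard_lt_ncard hss

end Affine

theorem stmt_0 (q : ℕ) (hq : IsPrimePow q)
    (𝔽 : Type) [Field 𝔽] [Fintype 𝔽] (hcard : Fintype.card 𝔽 = q)
    (n k1 k2 t : ℕ) (hn : 0 < n) (hk1pos : 0 < k1) (hk2pos : 0 < k2) (ht : 0 < t)
    (hk1 : t ≤ k1) (hk2 : t ≤ k2) (hn' : k1 + k2 + 3 ≤ n)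
    (F1 F2 : Set (Set (Fin n → 𝔽)))
    (hF1 : ∀ A ∈ F1, IsFlat 𝔽 k1 A) (hF2 : ∀ B ∈ F2, IsFlat 𝔽 k2 B)
    (hcross : CrossT 𝔽 t F1 F2)
    (hmax : ∀ G1 G2 : Set (Set (Fin n → 𝔽)),
      (∀ A ∈ G1, IsFlat 𝔽 k1 A) → (∀ B ∈ G2, IsFlat 𝔽 k2 B) → CrossT 𝔽 t G1 G2 →
      G1.ncard * G2.ncard ≤ F1.ncard * F2.ncard) :
    ∃ T : Set (Fin n → 𝔽), IsFlat 𝔽 t T ∧ (∀ A ∈ F1, T ⊆ A) ∧ (∀ B ∈ F2, T ⊆ B) := by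
  have hV : finrank 𝔽 ((Fin n → 𝔽) × 𝔽) = n + 1 := by simp
  obtain ⟨P, -, -, hP⟩ := grass_nonempty (bot_le : (⊥ : Submodule 𝔽 (Fin n → 𝔽)) ≤ ⊤)
    (K := t) (by simp) (by simp; omega)
  have hS₀ : finrank 𝔽 (coneOver P 0) = t + 1 := by rw [finrank_coneOver, hP]
  have hne₀ : (slice (coneOver P 0)).Nonempty := ⟨0, by simp [slice_coneOver]⟩
  have htriv := hmax (A3 𝔽 (slice (coneOver P 0)) k1) (A3 𝔽 (slice (coneOver P 0)) k2)
    (fun A hA => hA.1) (fun B hB => hB.1) <| by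
      rintro A ⟨hA, hA'⟩ B ⟨hB, hB'⟩
      obtain ⟨U, -, -, rfl⟩ := isFlat_iff.1 hA
      obtain ⟨U', -, -, rfl⟩ := isFlat_iff.1 hB
      rw [← slice_inf, dimGe_slice_iff]
      have hsub : slice (coneOver P 0) ⊆ slice (U ⊓ U') := Set.subset_inter hA' hB'
      exact ⟨hne₀.mono hsub, hS₀ ▸ Submodule.finrank_mono (le_of_slice_subset hne₀ hsub)⟩
  have hbig : flagCount (Fintype.card 𝔽) (n + 1) (k1 + 1) (t + 1) *
      flagCount (Fintype.card 𝔽) (n + 1) (k2 + 1) (t + 1) ≤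
      ((spanFamily k1 F1).ncard : ℚ) * (spanFamily k2 F2).ncard := by
    rw [← ncard_flats_through hS₀ hne₀ hk1, ← ncard_flats_through hS₀ hne₀ hk2,
      ncard_spanFamily hF1, ncard_spanFamily hF2]
    exact_mod_cast htriv
  obtain ⟨S, hS, hSF1, hSF2⟩ := exists_common_subspace (G₁ := spanFamily k1 F1) (G₂ := spanFamily k2 F2)
    (fun U hU => hU.1) (fun U hU => hU.1) (T := t + 1) (by omega) (by omega)
    (by rw [hV]; omega)
    (fun U hU U' hU' => (dimGe_slice_iff.1 (hcross _ hU.2 _ hU'.2)).2) (by rw [hV]; exact hbig)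
  rcases (slice S).eq_empty_or_nonempty with hemp | hne
  · have lt₁ := ncard_spanFamily_lt hF1 hS hemp hSF1 hk1 (by omega)
    have lt₂ := ncard_spanFamily_lt hF2 hS hemp hSF2 hk2 (by omega)
    exact absurd hbig (not_le.2 (mul_lt_mul'' lt₁ lt₂ (Nat.cast_nonneg _) (Nat.cast_nonneg _)))
  · refine ⟨slice S, isFlat_slice hS hne, fun A hA => ?_, fun B hB => ?_⟩
    · obtain ⟨U, hU, rfl⟩ := exists_mem_spanFamily hF1 hA
      exact slice_mono (hSF1 U hU)
    · obtain ⟨U, hU, rfl⟩ := exists_mem_spanFamily hF2 hB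
      exact slice_mono (hSF2 U hU)
end

section
/- Let q be a prime power and let d, n, t, k₁, …, k_d be positive integers with d ≥ 2, k₁ ≥ k₂ ≥ ⋯ ≥ k_d ≥ t and n ≥ k₁ + k₂ + 3. Suppose families F_i ⊆ M(k_i,n) for i = 1,…,d satisfy dim(F₁ ∩ F₂ ∩ ⋯ ∩ F_d) ≥ t for every choice of F_i ∈ F_i (i = 1,…,d), and the product ∏_{i=1}^d |F_i| is maximum among all d-tuples of families with this property. Then there exists a t-flat T such that F_i = {F ∈ M(k_i,n) : T ⊆ F} for every i ∈ {1,…,d}. -/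
open Module Set

namespace CrossEKR

section Gaussian

/-- The `q`-analogue `∏_{1 ≤ i ≤ m} (q ^ i - 1)` of the factorial (up to a power of `q - 1`). -/
def qFac (q : ℚ) (m : ℕ) : ℚ := ∏ i ∈ Finset.range m, (q ^ (i + 1) - 1)

/-- The Gaussian binomial coefficient `[m + j choose j]_q`. -/
def gauss (q : ℚ) (m j : ℕ) : ℚ := qFac q (m + j) / (qFac q m * qFac q j)

lemma pow_succ_sub_one_pos {q : ℚ} (hq : 2 ≤ q) (i : ℕ) : 0 < q ^ (i + 1) - 1 :=
  sub_pos.2 (one_lt_pow₀ (by linarith) (by omega))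

lemma qFac_pos {q : ℚ} (hq : 2 ≤ q) (m : ℕ) : 0 < qFac q m :=
  Finset.prod_pos fun i _ => pow_succ_sub_one_pos hq i

lemma gauss_pos {q : ℚ} (hq : 2 ≤ q) (m j : ℕ) : 0 < gauss q m j :=
  div_pos (qFac_pos hq _) (mul_pos (qFac_pos hq _) (qFac_pos hq _))

lemma qFac_succ (q : ℚ) (m : ℕ) : qFac q (m + 1) = qFac q m * (q ^ (m + 1) - 1) :=
  Finset.prod_range_succ _ _

lemma gauss_zero_right {q : ℚ} (hq : 2 ≤ q) (m : ℕ) : gauss q m 0 = 1 := by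
  have := qFac_pos hq m
  simp [gauss, qFac] at this ⊢
  exact this.ne'

lemma gauss_zero_left {q : ℚ} (hq : 2 ≤ q) (j : ℕ) : gauss q 0 j = 1 := by
  have := qFac_pos hq j
  simp [gauss, qFac] at this ⊢
  exact this.ne'

lemma gauss_succ_right {q : ℚ} (hq : 2 ≤ q) (m j : ℕ) :
    gauss q m (j + 1) * (q ^ (j + 1) - 1) = gauss q m j * (q ^ (m + j + 1) - 1) := by
  have h1 := (qFac_pos hq m).ne'
  have h2 := (qFac_pos hq j).ne'
  have h3 := (pow_succ_sub_one_pos hq j).ne'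
  rw [gauss, gauss, ← add_assoc, qFac_succ, qFac_succ]
  field_simp

lemma gauss_succ_left {q : ℚ} (hq : 2 ≤ q) (m j : ℕ) :
    gauss q (m + 1) j * (q ^ (m + 1) - 1) = gauss q m j * (q ^ (m + j + 1) - 1) := by
  have h1 := (qFac_pos hq m).ne'
  have h2 := (qFac_pos hq j).ne'
  have h3 := (pow_succ_sub_one_pos hq m).ne'
  rw [gauss, gauss, add_right_comm, qFac_succ, qFac_succ]
  field_simp

/-- The number `(q ^ (a + 1) - 1) / (q - 1)` of lines in a space of dimension `a + 1`. -/
def lineCount (q : ℚ) (a : ℕ) : ℚ := (q ^ (a + 1) - 1) / (q - 1)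

lemma lineCount_pos {q : ℚ} (hq : 2 ≤ q) (a : ℕ) : 0 < lineCount q a :=
  div_pos (pow_succ_sub_one_pos hq a) (by linarith)

lemma lineCount_lt {q : ℚ} (hq : 2 ≤ q) (a : ℕ) : lineCount q a < q ^ (a + 1) := by
  rw [lineCount, div_lt_iff₀ (by linarith)]
  have : 0 < q ^ (a + 1) := by positivity
  nlinarith

lemma gauss_mul_le {q : ℚ} (hq : 2 ≤ q) (m j : ℕ) :
    q ^ m * gauss q m j ≤ gauss q m (j + 1) := by
  have h := gauss_succ_right hq m j
  have h1 := pow_succ_sub_one_pos hq j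
  have h0 := gauss_pos hq m j
  refine le_of_mul_le_mul_right ?_ h1
  rw [h, mul_comm (q ^ m), mul_assoc]
  refine mul_le_mul_of_nonneg_left ?_ h0.le
  have : (1 : ℚ) ≤ q ^ m := one_le_pow₀ (by linarith)
  have e : q ^ (m + j + 1) = q ^ m * q ^ (j + 1) := by ring
  rw [e]; linarith

lemma gauss_succ_left_le {q : ℚ} (hq : 2 ≤ q) (x t : ℕ) :
    gauss q (x + 1) t ≤ 2 * q ^ t * gauss q x t := by
  have h := gauss_succ_left hq x t
  have h1 := pow_succ_sub_one_pos hq x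
  have h0 := gauss_pos hq x t
  refine le_of_mul_le_mul_right ?_ h1
  rw [h]
  have e : q ^ (x + t + 1) = q ^ t * q ^ (x + 1) := by ring
  have h2 : 2 ≤ q ^ (x + 1) := hq.trans (le_self_pow₀ (by linarith) (by omega))
  have ht : (0 : ℚ) < q ^ t := by positivity
  have : q ^ (x + t + 1) - 1 ≤ 2 * q ^ t * (q ^ (x + 1) - 1) := by rw [e]; nlinarith
  nlinarith

lemma gauss_step_lt {q : ℚ} (hq : 2 ≤ q) {a t m : ℕ} (hm : a + t + 2 ≤ m) (x e : ℕ) :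
    gauss q (x + 1) t * lineCount q a * gauss q m e < gauss q x t * gauss q m (e + 1) := by
  have h1 := gauss_succ_left_le hq x t
  have h2 := lineCount_lt hq a
  have h3 := gauss_mul_le hq m e
  have hx := gauss_pos hq x t
  have he := gauss_pos hq m e
  have hl := lineCount_pos hq a
  calc gauss q (x + 1) t * lineCount q a * gauss q m e
      ≤ (2 * q ^ t * gauss q x t) * lineCount q a * gauss q m e := by gcongr
    _ < (2 * q ^ t * gauss q x t) * q ^ (a + 1) * gauss q m e := by gcongr
    _ = gauss q x t * ((2 * q ^ (a + t + 1)) * gauss q m e) := by ring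
    _ ≤ gauss q x t * ((q * q ^ (a + t + 1)) * gauss q m e) := by gcongr
    _ = gauss q x t * (q ^ (a + t + 2) * gauss q m e) := by ring
    _ ≤ gauss q x t * (q ^ m * gauss q m e) := by gcongr; linarith
    _ ≤ gauss q x t * gauss q m (e + 1) := by gcongr

lemma gauss_cover_le {q : ℚ} (hq : 2 ≤ q) {a t m : ℕ} (hm : a + t + 2 ≤ m) (x e : ℕ) :
    gauss q x t * lineCount q a ^ x * gauss q m e ≤ gauss q m (x + e) ∧
      (x ≠ 0 → gauss q x t * lineCount q a ^ x * gauss q m e < gauss q m (x + e)) := by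
  induction x generalizing e with
  | zero => simp [gauss_zero_left hq]
  | succ x ih =>
    have hl := pow_pos (lineCount_pos hq a) x
    have h : gauss q (x + 1) t * lineCount q a ^ (x + 1) * gauss q m e <
        gauss q m (x + 1 + e) := by
      calc _ = lineCount q a ^ x * (gauss q (x + 1) t * lineCount q a * gauss q m e) := by ring
        _ < lineCount q a ^ x * (gauss q x t * gauss q m (e + 1)) :=
          mul_lt_mul_of_pos_left (gauss_step_lt hq hm x e) hl
        _ = gauss q x t * lineCount q a ^ x * gauss q m (e + 1) := by ring
        _ ≤ gauss q m (x + (e + 1)) := (ih (e + 1)).1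
        _ = _ := by congr 1; ring
    exact ⟨h.le, fun _ => h⟩

end Gaussian

section Linear

variable {F V : Type*} [Field F] [AddCommGroup V] [Module F V]

lemma finrank_sup_span_singleton [FiniteDimensional F V] {S : Submodule F V} {v : V}
    (hv : v ∉ S) : finrank F ↥(S ⊔ Submodule.span F {v}) = finrank F S + 1 := by
  have hv0 : v ≠ 0 := fun h => hv (h ▸ S.zero_mem)
  have h := Submodule.finrank_sup_add_finrank_inf_eq S (Submodule.span F {v})
  have hd : S ⊓ Submodule.span F {v} = ⊥ :=
    ((Submodule.disjoint_span_singleton' hv0).2 hv).eq_bot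
  rw [hd, finrank_bot, finrank_span_singleton hv0] at h
  simpa using h

lemma exists_between_finrank_eq [FiniteDimensional F V] {S T : Submodule F V} (h : S ≤ T) {k : ℕ}
    (hS : finrank F S ≤ k) (hT : k ≤ finrank F T) :
    ∃ K, S ≤ K ∧ K ≤ T ∧ finrank F K = k := by
  induction k, hS using Nat.le_induction with
  | base => exact ⟨S, le_rfl, h, rfl⟩
  | succ k _ ih =>
    obtain ⟨K, hSK, hKT, hK⟩ := ih (by omega)
    obtain ⟨v, hvT, hvK⟩ := SetLike.exists_of_lt
      (lt_of_le_of_ne hKT fun e => by rw [e] at hK; omega)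
    exact ⟨K ⊔ Submodule.span F {v}, hSK.trans le_sup_left,
      sup_le hKT ((Submodule.span_singleton_le_iff_mem _ _).2 hvT),
      by rw [finrank_sup_span_singleton hvK, hK]⟩

end Linear

section Counting

variable {F V : Type*} [Field F] [AddCommGroup V] [Module F V] [Finite V]

/-- The `k`-dimensional subspaces containing the subspace `T`. -/
noncomputable def superspaces (T : Submodule F V) (k : ℕ) : Finset (Submodule F V) :=
  (Set.toFinite {K : Submodule F V | T ≤ K ∧ finrank F K = k}).toFinset

@[simp] lemma mem_superspaces {T K : Submodule F V} {k : ℕ} :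
    K ∈ superspaces T k ↔ T ≤ K ∧ finrank F K = k := by
  simp [superspaces]

lemma natCard_submodule (S : Submodule F V) : Nat.card S = Nat.card F ^ finrank F S :=
  Module.natCard_eq_pow_finrank

open Classical in
/-- Double counting of the pairs `(v, K)` with `v ∈ K \ T`. -/
lemma card_superspaces_mul (T : Submodule F V) (k : ℕ) (c : ℚ)
    (hc : ∀ v ∉ T, ((superspaces (T ⊔ Submodule.span F {v}) k).card : ℚ) = c) :
    ((superspaces T k).card : ℚ) * ((Nat.card F : ℚ) ^ k - (Nat.card F : ℚ) ^ finrank F T) =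
      ((Nat.card F : ℚ) ^ finrank F V - (Nat.card F : ℚ) ^ finrank F T) * c := by
  have := Fintype.ofFinite V
  have hcard : ∀ K : Submodule F V, T ≤ K →
      (((Finset.univ.filter fun v => v ∉ T).filter fun v => v ∈ K).card : ℚ) =
        (Nat.card F : ℚ) ^ finrank F K - (Nat.card F : ℚ) ^ finrank F T := by
    intro K hK
    have e : (Finset.univ.filter fun v => v ∉ T).filter (fun v => v ∈ K) =
        (Finset.univ.filter fun v => v ∈ K) \ (Finset.univ.filter fun v => v ∈ T) := by
      ext v; simp [and_comm]
    have hs : ∀ S : Submodule F V, (Finset.univ.filter fun v => v ∈ S).card =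
        Nat.card F ^ finrank F S := by
      intro S
      rw [← natCard_submodule, Nat.card_eq_fintype_card, Fintype.card_subtype]
    rw [e, Finset.cast_card_sdiff, hs, hs]
    · push_cast; rfl
    · intro v; simpa using fun h => hK h
  have key := Finset.sum_card_bipartiteAbove_eq_sum_card_bipartiteBelow
    (s := superspaces T k) (t := Finset.univ.filter fun v => v ∉ T)
    (fun (K : Submodule F V) (v : V) => v ∈ K)
  have key' := congrArg (Nat.cast (R := ℚ)) key
  push_cast at key'
  rw [Finset.sum_congr rfl (g := fun _ => (Nat.card F : ℚ) ^ k - (Nat.card F : ℚ) ^ finrank F T),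
    Finset.sum_congr (s₁ := Finset.univ.filter fun v => v ∉ T) rfl (g := fun _ => c)] at key'
  · have h1 := hcard ⊤ le_top
    simp only [Finset.sum_const, nsmul_eq_mul] at key'
    simp only [Submodule.mem_top, Finset.filter_true, finrank_top] at h1
    rw [key', h1]
  · intro v hv
    rw [← hc v (by simpa using hv)]
    congr 2
    ext K
    simp [Finset.bipartiteBelow]
    tauto
  · intro K hK
    rw [mem_superspaces] at hK
    rw [← hK.2, ← hcard K hK.1]
    rfl

lemma two_le_natCard [Finite F] : (2 : ℚ) ≤ Nat.card F := by
  exact_mod_cast (Finite.one_lt_card : 1 < Nat.card F)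

lemma card_superspaces [Finite F] {m k : ℕ} (hk : k + m = finrank F V) (j : ℕ)
    (T : Submodule F V) (hT : finrank F T + j = k) :
    ((superspaces T k).card : ℚ) = gauss (Nat.card F) m j := by
  have hq := two_le_natCard (F := F)
  induction j generalizing T with
  | zero =>
    have : superspaces T k = {T} := by
      ext K
      simp only [mem_superspaces, Finset.mem_singleton]
      refine ⟨fun h => (Submodule.eq_of_le_of_finrank_eq h.1 (by omega)).symm, ?_⟩
      rintro rfl
      exact ⟨le_rfl, by omega⟩
    rw [this, gauss_zero_right hq]; simp
  | succ j ih =>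
    have h := card_superspaces_mul T k (gauss (Nat.card F) m j) fun v hv =>
      ih _ (by rw [finrank_sup_span_singleton hv]; omega)
    have h2 := gauss_succ_right hq m j
    have hp := pow_succ_sub_one_pos hq j
    set q : ℚ := (Nat.card F : ℚ)
    have hs : (0 : ℚ) < q ^ finrank F T := by positivity
    have e1 : q ^ k = q ^ finrank F T * q ^ (j + 1) := by rw [← pow_add, hT]
    have e2 : q ^ finrank F V = q ^ finrank F T * q ^ (m + j + 1) := by
      rw [← pow_add, ← hk, ← hT]; congr 1; ring
    rw [e1, e2] at h
    refine mul_right_cancel₀ (mul_pos hs hp).ne' ?_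
    linear_combination h - q ^ finrank F T * h2

open Classical in
/-- If every member of `B` meets `A` in dimension at least `t` while `S` does not, then the
members of `B` above `S` are covered by few subspaces of dimension one more. -/
lemma card_filter_le_of_not_cover [Finite F] {t a : ℕ} (A S : Submodule F V)
    (B : Finset (Submodule F V)) (hA : finrank F A = t + a)
    (hB : ∀ K ∈ B, t ≤ finrank F ↥(K ⊓ A)) (hS : finrank F ↥(S ⊓ A) < t) (M : ℚ)
    (hM : ∀ S' : Submodule F V, S ≤ S' → finrank F S' = finrank F S + 1 →
      ((B.filter (S' ≤ ·)).card : ℚ) ≤ M) :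
    ((B.filter (S ≤ ·)).card : ℚ) ≤ lineCount (Nat.card F) a * M := by
  have := Fintype.ofFinite V
  have hq := two_le_natCard (F := F)
  obtain ⟨C, hCA, hSC, hC⟩ : ∃ C ≤ A, S ⊓ C = ⊥ ∧ finrank F C = a + 1 := by
    obtain ⟨D, hD⟩ := Submodule.exists_isCompl (S ⊓ A)
    have hDA : a + 1 ≤ finrank F ↥(D ⊓ A) := by
      have h1 := Submodule.finrank_sup_add_finrank_inf_eq D A
      have h2 := Submodule.finrank_add_eq_of_isCompl hD
      have h3 := Submodule.finrank_le (D ⊔ A)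
      omega
    obtain ⟨C, -, hCD, hC⟩ := exists_between_finrank_eq (bot_le (a := D ⊓ A)) (k := a + 1)
      (by simp) hDA
    refine ⟨C, hCD.trans inf_le_right, ?_, hC⟩
    rw [eq_bot_iff, ← hD.inf_eq_bot]
    exact le_inf (le_inf inf_le_left (inf_le_right.trans (hCD.trans inf_le_right)))
      (inf_le_right.trans (hCD.trans inf_le_left))
  have hpts : ∀ D : Submodule F V, ((Finset.univ.filter fun v => v ∈ D ∧ v ≠ 0).card : ℚ) =
      (Nat.card F : ℚ) ^ finrank F D - 1 := by
    intro D
    have e : (Finset.univ.filter fun v => v ∈ D ∧ v ≠ 0) =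
        (Finset.univ.filter fun v => v ∈ D) \ {0} := by ext v; simp
    rw [e, Finset.cast_card_sdiff (by simp), ← Fintype.card_subtype,
      ← Nat.card_eq_fintype_card, natCard_submodule]
    simp
  have key := Finset.sum_card_bipartiteAbove_eq_sum_card_bipartiteBelow
    (s := B.filter (S ≤ ·)) (t := Finset.univ.filter fun v => v ∈ C ∧ v ≠ 0)
    (fun (K : Submodule F V) (v : V) => v ∈ K)
  have key' := congrArg (Nat.cast (R := ℚ)) key
  push_cast at key'
  have hlow : ((B.filter (S ≤ ·)).card : ℚ) * (Nat.card F - 1) ≤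
      ∑ K ∈ B.filter (S ≤ ·), ((Finset.bipartiteAbove (fun (K : Submodule F V) (v : V) => v ∈ K)
        (Finset.univ.filter fun v => v ∈ C ∧ v ≠ 0) K).card : ℚ) := by
    rw [← nsmul_eq_mul]
    refine Finset.card_nsmul_le_sum _ _ _ fun K hK => ?_
    have hKA := hB K (Finset.mem_filter.1 hK).1
    have h1 : 1 ≤ finrank F ↥(K ⊓ C) := by
      have h1 := Submodule.finrank_sup_add_finrank_inf_eq (K ⊓ A) C
      have h2 := Submodule.finrank_mono (sup_le (inf_le_right : K ⊓ A ≤ A) hCA)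
      rw [inf_assoc, inf_eq_right.2 hCA] at h1
      omega
    have e : (Finset.bipartiteAbove (fun (K : Submodule F V) (v : V) => v ∈ K)
        (Finset.univ.filter fun v => v ∈ C ∧ v ≠ 0) K) =
        Finset.univ.filter fun v => v ∈ K ⊓ C ∧ v ≠ 0 := by
      ext v; simp [Finset.bipartiteAbove]; tauto
    rw [e, hpts]
    have : (Nat.card F : ℚ) ≤ (Nat.card F : ℚ) ^ finrank F ↥(K ⊓ C) :=
      le_self_pow₀ (by linarith) (by omega)
    linarith
  have hup : ∑ v ∈ Finset.univ.filter (fun v => v ∈ C ∧ v ≠ 0),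
      ((Finset.bipartiteBelow (fun (K : Submodule F V) (v : V) => v ∈ K)
        (B.filter (S ≤ ·)) v).card : ℚ) ≤ ((Nat.card F : ℚ) ^ (a + 1) - 1) * M := by
    rw [← hC, ← hpts C, ← nsmul_eq_mul]
    refine Finset.sum_le_card_nsmul _ _ _ fun v hv => ?_
    simp only [Finset.mem_filter, Finset.mem_univ, true_and] at hv
    have hvS : v ∉ S := fun h => hv.2 (by
      have : v ∈ S ⊓ C := ⟨h, hv.1⟩
      rwa [hSC, Submodule.mem_bot] at this)
    refine le_trans (le_of_eq ?_) (hM _ le_sup_left (finrank_sup_span_singleton hvS))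
    congr 2
    ext K
    simp [Finset.bipartiteBelow]
    tauto
  rw [lineCount, div_mul_eq_mul_div, le_div_iff₀ (by linarith)]
  linarith

open Classical in
lemma card_filter_le_of_no_small_cover [Finite F] {t a m e b x : ℕ}
    (A B : Finset (Submodule F V)) (hA : ∀ K ∈ A, finrank F K = t + a)
    (hB : ∀ K ∈ B, finrank F K = b) (hAB : ∀ K ∈ A, ∀ L ∈ B, t ≤ finrank F ↥(L ⊓ K))
    (hbm : b + m = finrank F V) (hbe : t + x + e = b)
    (hx : ∀ S : Submodule F V, finrank F S < t + x → ∃ K ∈ A, finrank F ↥(S ⊓ K) < t)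
    (i : ℕ) (S : Submodule F V) (hS : finrank F S + i = t + x) :
    ((B.filter (S ≤ ·)).card : ℚ) ≤ lineCount (Nat.card F) a ^ i * gauss (Nat.card F) m e := by
  induction i generalizing S with
  | zero =>
    rw [pow_zero, one_mul, ← card_superspaces hbm e S (by omega)]
    refine Nat.cast_le.2 (Finset.card_le_card fun K hK => ?_)
    rw [Finset.mem_filter] at hK
    exact mem_superspaces.2 ⟨hK.2, hB K hK.1⟩
  | succ i ih =>
    obtain ⟨K, hK, hKS⟩ := hx S (by omega)
    rw [pow_succ', mul_assoc]
    exact card_filter_le_of_not_cover K S B (hA K hK) (hAB K hK) hKS _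
      fun S' _ hS' => ih S' (by omega)

open Classical in
lemma card_le_of_cover [Finite F] {t y : ℕ} (B : Finset (Submodule F V)) (W : Submodule F V)
    (hW : finrank F W = t + y) (hB : ∀ K ∈ B, t ≤ finrank F ↥(W ⊓ K)) (M : ℚ)
    (hM : ∀ S : Submodule F V, finrank F S = t → ((B.filter (S ≤ ·)).card : ℚ) ≤ M) :
    (B.card : ℚ) ≤ gauss (Nat.card F) y t * M := by
  have hsub : B ⊆ (superspaces (⊥ : Submodule F W) t).biUnion
      fun U => B.filter (U.map W.subtype ≤ ·) := by
    intro K hK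
    obtain ⟨U, -, hUK, hU⟩ := exists_between_finrank_eq (bot_le (a := W ⊓ K)) (k := t)
      (by simp) (hB K hK)
    have hmap : (U.comap W.subtype).map W.subtype = U := by
      rw [Submodule.map_comap_subtype, inf_eq_right.2 (hUK.trans inf_le_left)]
    simp only [Finset.mem_biUnion, mem_superspaces, Finset.mem_filter]
    refine ⟨U.comap W.subtype, ⟨bot_le, ?_⟩, hK, ?_⟩
    · rw [← Submodule.finrank_map_subtype_eq, hmap, hU]
    · rw [hmap]; exact hUK.trans inf_le_right
  have hc := card_superspaces (F := F) (V := W) (m := y) (k := t) hW.symm t ⊥ (by simp)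
  calc (B.card : ℚ) ≤ ∑ U ∈ superspaces (⊥ : Submodule F W) t,
        ((B.filter (U.map W.subtype ≤ ·)).card : ℚ) := by
        exact_mod_cast (Finset.card_le_card hsub).trans Finset.card_biUnion_le
    _ ≤ (superspaces (⊥ : Submodule F W) t).card • M := by
        refine Finset.sum_le_card_nsmul _ _ _ fun U hU => hM _ ?_
        rw [Submodule.finrank_map_subtype_eq]
        exact (mem_superspaces.1 hU).2
    _ = _ := by rw [nsmul_eq_mul, hc]

lemma exists_minimal_cover {t : ℕ} (A B : Finset (Submodule F V)) (hB : B.Nonempty)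
    {b : ℕ} (hBb : ∀ K ∈ B, finrank F K = t + b)
    (hAB : ∀ K ∈ A, ∀ L ∈ B, t ≤ finrank F ↥(L ⊓ K)) (hA : A.Nonempty) :
    ∃ x ≤ b, (∃ W : Submodule F V, finrank F W = t + x ∧ ∀ K ∈ A, t ≤ finrank F ↥(W ⊓ K)) ∧
      ∀ S : Submodule F V, finrank F S < t + x → ∃ K ∈ A, finrank F ↥(S ⊓ K) < t := by
  classical
  have hex : ∃ s, ∃ W : Submodule F V, finrank F W = s ∧ ∀ K ∈ A, t ≤ finrank F ↥(W ⊓ K) := by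
    obtain ⟨L, hL⟩ := hB
    exact ⟨_, L, rfl, fun K hK => hAB K hK L hL⟩
  have hle : Nat.find hex ≤ t + b := by
    obtain ⟨L, hL⟩ := hB
    exact Nat.find_min' hex ⟨L, hBb L hL, fun K hK => hAB K hK L hL⟩
  obtain ⟨W, hW, hWA⟩ := Nat.find_spec hex
  have ht : t ≤ Nat.find hex := by
    obtain ⟨K, hK⟩ := hA
    rw [← hW]
    exact (hWA K hK).trans (Submodule.finrank_mono inf_le_left)
  refine ⟨Nat.find hex - t, by omega, ⟨W, by omega, hWA⟩, fun S hS => ?_⟩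
  by_contra! h
  have := Nat.find_min' hex ⟨S, rfl, h⟩
  omega

lemma le_of_finrank_le_finrank_inf {W K : Submodule F V} (h : finrank F W ≤ finrank F ↥(W ⊓ K)) :
    W ≤ K := by
  have := Submodule.eq_of_le_of_finrank_le (inf_le_left : W ⊓ K ≤ W) h
  exact inf_eq_left.1 this

/-- If all members of `A` contain the `t`-space `T` and meet `L` in dimension at least `t`, where
`T` is not contained in `L`, then `A` is smaller than the family of all superspaces of `T`. -/
lemma card_lt_of_not_le [Finite F] {t a b m : ℕ} (A : Finset (Submodule F V))
    (T L : Submodule F V) (hT : finrank F T = t) (hL : finrank F L = t + b)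
    (hA : ∀ K ∈ A, finrank F K = t + a) (hTA : ∀ K ∈ A, T ≤ K)
    (hAL : ∀ K ∈ A, t ≤ finrank F ↥(K ⊓ L)) (ham : t + a + m = finrank F V)
    (hm : b + t + 2 ≤ m) (hTL : ¬ T ≤ L) :
    (A.card : ℚ) < gauss (Nat.card F) m a := by
  classical
  have hq := two_le_natCard (F := F)
  have hAT : A.filter (T ≤ ·) = A := Finset.filter_true_of_mem hTA
  have hTL' : finrank F ↥(T ⊓ L) < t := by
    by_contra! h
    exact hTL (le_of_finrank_le_finrank_inf (hT.trans_le h))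
  have step := card_filter_le_of_not_cover L T A hL hAL hTL'
  rw [hAT] at step
  cases a with
  | zero =>
    refine (step 0 fun S' _ hS' => ?_).trans_lt (by simpa using gauss_pos hq m 0)
    rw [Finset.card_eq_zero.2, Nat.cast_zero]
    refine Finset.filter_eq_empty_iff.2 fun K hK hle => ?_
    have := Submodule.finrank_mono hle
    have := hA K hK
    omega
  | succ a =>
    refine (step (gauss (Nat.card F) m a) fun S' _ hS' => ?_).trans_lt ?_
    · rw [← card_superspaces ham a S' (by omega)]
      refine Nat.cast_le.2 (Finset.card_le_card fun K hK => ?_)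
      rw [Finset.mem_filter] at hK
      exact mem_superspaces.2 ⟨hK.2, hA K hK.1⟩
    · refine lt_of_lt_of_le ?_ (gauss_mul_le hq m a)
      have h0 := gauss_pos hq m a
      have h1 : (Nat.card F : ℚ) ^ (b + 1) ≤ (Nat.card F : ℚ) ^ m :=
        pow_le_pow_right₀ (by linarith) (by omega)
      have h2 := lineCount_lt hq b
      gcongr
      linarith

/-- The cross-intersecting Erdős–Ko–Rado theorem for vector spaces. -/
theorem card_mul_card_lt_or_eq_superspaces [Finite F] {t a b m m' : ℕ}
    (A B : Finset (Submodule F V)) (hA0 : A.Nonempty) (hB0 : B.Nonempty)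
    (hA : ∀ K ∈ A, finrank F K = t + a) (hB : ∀ K ∈ B, finrank F K = t + b)
    (hAB : ∀ K ∈ A, ∀ L ∈ B, t ≤ finrank F ↥(K ⊓ L))
    (ham : t + a + m = finrank F V) (hbm : t + b + m' = finrank F V)
    (hdim : t + a + (t + b) + 2 ≤ finrank F V) :
    (A.card : ℚ) * B.card < gauss (Nat.card F) m a * gauss (Nat.card F) m' b ∨
      ∃ T : Submodule F V, finrank F T = t ∧
        A = superspaces T (t + a) ∧ B = superspaces T (t + b) := by
  classical
  have hq := two_le_natCard (F := F)
  have hBA : ∀ L ∈ B, ∀ K ∈ A, t ≤ finrank F ↥(L ⊓ K) := fun L hL K hK => by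
    rw [inf_comm]; exact hAB K hK L hL
  obtain ⟨x, hxb, ⟨W, hW, hWA⟩, hx⟩ := exists_minimal_cover A B hB0 hB
    (fun K hK L hL => hBA L hL K hK) hA0
  obtain ⟨y, hya, ⟨U, hU, hUB⟩, hy⟩ := exists_minimal_cover B A hA0 hA
    (fun L hL K hK => hAB K hK L hL) hB0
  obtain ⟨e, rfl⟩ := Nat.exists_eq_add_of_le hxb
  obtain ⟨e', rfl⟩ := Nat.exists_eq_add_of_le hya
  have h1 : (B.card : ℚ) ≤ gauss (Nat.card F) y t *
      (lineCount (Nat.card F) (y + e') ^ x * gauss (Nat.card F) m' e) :=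
    card_le_of_cover B U hU hUB _ fun S hS =>
      card_filter_le_of_no_small_cover A B hA hB (fun K hK L hL => hBA L hL K hK) hbm
        (by omega) hx x S (by omega)
  have h2 : (A.card : ℚ) ≤ gauss (Nat.card F) x t *
      (lineCount (Nat.card F) (x + e) ^ y * gauss (Nat.card F) m e') :=
    card_le_of_cover A W hW hWA _ fun S hS =>
      card_filter_le_of_no_small_cover B A hB hA (fun L hL K hK => hAB K hK L hL) ham
        (by omega) hy y S (by omega)
  have g1 := gauss_cover_le hq (a := y + e') (t := t) (m := m') (by omega) x e
  have g2 := gauss_cover_le hq (a := x + e) (t := t) (m := m) (by omega) y e'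
  set q : ℚ := (Nat.card F : ℚ)
  have hA' : (0 : ℚ) < A.card := by exact_mod_cast hA0.card_pos
  have hB' : (0 : ℚ) < B.card := by exact_mod_cast hB0.card_pos
  have hprod : (A.card : ℚ) * B.card ≤
      (gauss q y t * lineCount q (x + e) ^ y * gauss q m e') *
        (gauss q x t * lineCount q (y + e') ^ x * gauss q m' e) := by
    calc _ ≤ (gauss q x t * (lineCount q (x + e) ^ y * gauss q m e')) *
        (gauss q y t * (lineCount q (y + e') ^ x * gauss q m' e)) :=
          mul_le_mul h2 h1 hB'.le (hA'.le.trans h2)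
      _ = _ := by ring
  have p1 : 0 < gauss q x t * lineCount q (y + e') ^ x * gauss q m' e :=
    mul_pos (mul_pos (gauss_pos hq _ _) (pow_pos (lineCount_pos hq _) _)) (gauss_pos hq _ _)
  have p2 : 0 < gauss q y t * lineCount q (x + e) ^ y * gauss q m e' :=
    mul_pos (mul_pos (gauss_pos hq _ _) (pow_pos (lineCount_pos hq _) _)) (gauss_pos hq _ _)
  by_cases hx0 : x = 0
  swap
  · exact Or.inl (hprod.trans_lt (mul_lt_mul' g2.1 (g1.2 hx0) p1.le (gauss_pos hq _ _)))
  by_cases hy0 : y = 0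
  swap
  · exact Or.inl (hprod.trans_lt (mul_lt_mul (g2.2 hy0) g1.1 p1 (gauss_pos hq _ _).le))
  have h1' : (B.card : ℚ) ≤ gauss q m' (x + e) := by
    simpa [hx0, hy0, gauss_zero_left hq] using h1
  have h2' : (A.card : ℚ) ≤ gauss q m (y + e') := by
    simpa [hx0, hy0, gauss_zero_left hq] using h2
  have hWt : finrank F W = t := by omega
  have hWA' : ∀ K ∈ A, W ≤ K := fun K hK =>
    le_of_finrank_le_finrank_inf (hWt.trans_le (hWA K hK))
  by_cases hWB : ∀ L ∈ B, W ≤ L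
  swap
  · push Not at hWB
    obtain ⟨L, hL, hWL⟩ := hWB
    have h3 := card_lt_of_not_le A W L hWt (hB L hL) hA hWA' (fun K hK => hAB K hK L hL) ham
      (by omega) hWL
    exact Or.inl (mul_lt_mul h3 h1' hB' (gauss_pos hq _ _).le)
  have hAs : A ⊆ superspaces W (t + (y + e')) := fun K hK => mem_superspaces.2 ⟨hWA' K hK, hA K hK⟩
  have hBs : B ⊆ superspaces W (t + (x + e)) := fun K hK => mem_superspaces.2 ⟨hWB K hK, hB K hK⟩
  have cA := card_superspaces ham (y + e') W (by omega)
  have cB := card_superspaces hbm (x + e) W (by omega)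
  by_cases hAe : A = superspaces W (t + (y + e'))
  · by_cases hBe : B = superspaces W (t + (x + e))
    · exact Or.inr ⟨W, hWt, hAe, hBe⟩
    · have := Finset.card_lt_card (lt_of_le_of_ne hBs hBe)
      rw [← Nat.cast_lt (α := ℚ), cB] at this
      exact Or.inl (mul_lt_mul' h2' this hB'.le (gauss_pos hq _ _))
  · have := Finset.card_lt_card (lt_of_le_of_ne hAs hAe)
    rw [← Nat.cast_lt (α := ℚ), cA] at this
    exact Or.inl (mul_lt_mul this h1' hB' (gauss_pos hq _ _).le)

lemma le_of_superspaces_subset {T T' : Submodule F V} {k : ℕ} (hT : finrank F T ≤ k)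
    (hk : k < finrank F V) (h : superspaces T k ⊆ superspaces T' k) : T' ≤ T := by
  intro v hv
  by_contra hvT
  obtain ⟨f, hf, hTf⟩ := Submodule.exists_le_ker_of_notMem hvT
  have hker : finrank F V ≤ finrank F (LinearMap.ker f) + 1 := by
    have h1 := f.finrank_range_add_finrank_ker
    have h2 := Submodule.finrank_le (LinearMap.range f)
    rw [finrank_self] at h2
    omega
  obtain ⟨K, hTK, hKf, hK⟩ := exists_between_finrank_eq hTf hT (by omega)
  have hT'K := (mem_superspaces.1 (h (mem_superspaces.2 ⟨hTK, hK⟩))).1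
  exact hf (hKf (hT'K hv))

lemma eq_of_superspaces_eq {T T' : Submodule F V} {k : ℕ} (hT : finrank F T ≤ k)
    (hT' : finrank F T' ≤ k) (hk : k < finrank F V) (h : superspaces T k = superspaces T' k) :
    T = T' :=
  le_antisymm (le_of_superspaces_subset hT' hk h.ge) (le_of_superspaces_subset hT hk h.le)

end Counting

section Affine

variable {F : Type} [Field F] {n : ℕ}

/-- The linear subspace of `F^n × F` spanned by the points `(v, 1)` with `v ∈ A`. -/
def cone (A : Set (Fin n → F)) : Submodule F ((Fin n → F) × F) :=
  Submodule.span F ((fun v => (v, (1 : F))) '' A)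

lemma cone_mono {A B : Set (Fin n → F)} (h : A ⊆ B) : cone A ≤ cone B :=
  Submodule.span_mono (Set.image_mono h)

/-- The linear map `(w, c) ↦ w - c • x`. -/
def slice (x : Fin n → F) : (Fin n → F) × F →ₗ[F] (Fin n → F) :=
  LinearMap.fst F _ _ - (LinearMap.snd F (Fin n → F) F).smulRight x

@[simp] lemma slice_apply (x w : Fin n → F) (c : F) : slice x (w, c) = w - c • x := rfl

lemma finrank_comap_slice (P : Submodule F (Fin n → F)) (x : Fin n → F) :
    finrank F ↥(P.comap (slice x)) = finrank F P + 1 := by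
  have hle : P.map (LinearMap.inl F (Fin n → F) F) ≤ P.comap (slice x) := by
    rintro _ ⟨w, hw, rfl⟩
    simpa using hw
  have hx : (x, (1 : F)) ∉ P.map (LinearMap.inl F (Fin n → F) F) := by
    rintro ⟨w, -, h⟩
    simpa using congrArg Prod.snd h
  have e : P.comap (slice x) =
      P.map (LinearMap.inl F (Fin n → F) F) ⊔ Submodule.span F {(x, (1 : F))} := by
    refine le_antisymm ?_ (sup_le hle ?_)
    · rintro ⟨w, c⟩ h
      refine Submodule.mem_sup.2 ⟨(w - c • x, 0), ⟨w - c • x, h, rfl⟩, c • (x, 1),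
        Submodule.smul_mem _ _ (Submodule.mem_span_singleton_self _), ?_⟩
      simp
    · rw [Submodule.span_singleton_le_iff_mem]
      simp
  rw [e, finrank_sup_span_singleton hx,
    (P.equivMapOfInjective (LinearMap.inl F (Fin n → F) F) LinearMap.inl_injective).finrank_eq]

lemma cone_setOf (P : Submodule F (Fin n → F)) (x : Fin n → F) :
    cone {v | v - x ∈ P} = P.comap (slice x) := by
  refine le_antisymm (Submodule.span_le.2 ?_) ?_
  · rintro _ ⟨v, hv, rfl⟩
    simpa using hv
  · rintro ⟨w, c⟩ h
    have hp : w - c • x ∈ P := h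
    have m : ∀ v, v - x ∈ P → (v, (1 : F)) ∈ cone {v | v - x ∈ P} :=
      fun v hv => Submodule.subset_span ⟨v, hv, rfl⟩
    have h1 := m (w - c • x + x) (by simpa using hp)
    have h2 := m x (by simp)
    have := Submodule.add_mem _ (Submodule.sub_mem _ h1 h2) (Submodule.smul_mem _ c h2)
    simpa using this

lemma mem_iff_mem_cone {k : ℕ} {A : Set (Fin n → F)} (hA : IsFlat F k A) (v : Fin n → F) :
    v ∈ A ↔ (v, (1 : F)) ∈ cone A := by
  obtain ⟨P, x, -, rfl⟩ := hA
  rw [cone_setOf]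
  simp

lemma finrank_cone {k : ℕ} {A : Set (Fin n → F)} (hA : IsFlat F k A) :
    finrank F (cone A) = k + 1 := by
  obtain ⟨P, x, rfl, rfl⟩ := hA
  rw [cone_setOf, finrank_comap_slice]

lemma subset_iff_cone_le {j k : ℕ} {A B : Set (Fin n → F)} (hA : IsFlat F j A)
    (hB : IsFlat F k B) : A ⊆ B ↔ cone A ≤ cone B :=
  ⟨cone_mono, fun h v hv => (mem_iff_mem_cone hB v).2 (h ((mem_iff_mem_cone hA v).1 hv))⟩

lemma exists_flat_cone_eq {k : ℕ} (K : Submodule F ((Fin n → F) × F))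
    (hK : finrank F K = k + 1) (hinf : ¬ K ≤ LinearMap.ker (LinearMap.snd F (Fin n → F) F)) :
    ∃ A : Set (Fin n → F), IsFlat F k A ∧ cone A = K := by
  obtain ⟨⟨w, c⟩, hw, hc⟩ := SetLike.not_le_iff_exists.1 hinf
  have hc0 : c ≠ 0 := hc
  have hx : (c⁻¹ • w, (1 : F)) ∈ K := by
    have := K.smul_mem c⁻¹ hw
    simpa [hc0] using this
  set x := c⁻¹ • w
  have e : (K.comap (LinearMap.inl F (Fin n → F) F)).comap (slice x) = K := by
    ext ⟨v, b⟩
    have hb := K.smul_mem b hx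
    have hs : (v, b) = (v - b • x, (0 : F)) + b • (x, (1 : F)) := by simp
    simp only [Submodule.mem_comap, slice_apply, LinearMap.inl_apply]
    rw [hs, K.add_mem_iff_left hb]
  refine ⟨{v | v - x ∈ K.comap (LinearMap.inl F (Fin n → F) F)}, ⟨_, x, ?_, rfl⟩, ?_⟩
  · have h := finrank_comap_slice (K.comap (LinearMap.inl F (Fin n → F) F)) x
    rw [e, hK] at h
    omega
  · rw [cone_setOf, e]

lemma not_cone_le_ker {k : ℕ} {A : Set (Fin n → F)} (hA : IsFlat F k A) :
    ¬ cone A ≤ LinearMap.ker (LinearMap.snd F (Fin n → F) F) := by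
  obtain ⟨P, x, -, rfl⟩ := hA
  intro h
  have : (x, (1 : F)) ∈ cone {v | v - x ∈ P} := Submodule.subset_span ⟨x, by simp, rfl⟩
  simpa using h this

lemma exists_isFlat {t : ℕ} (h : t ≤ n) : ∃ T : Set (Fin n → F), IsFlat F t T := by
  obtain ⟨P, -, -, hP⟩ := exists_between_finrank_eq (F := F) (V := Fin n → F) (S := ⊥) (T := ⊤)
    bot_le (k := t) (by simp) (by simpa using h)
  exact ⟨_, P, 0, hP, rfl⟩

lemma finrank_cone_space : finrank F ((Fin n → F) × F) = n + 1 := by simp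

lemma finrank_cone_inf_cone {t : ℕ} {A B C : Set (Fin n → F)} (hC : DimGe F t C) (hA : C ⊆ A)
    (hB : C ⊆ B) : t + 1 ≤ finrank F ↥(cone A ⊓ cone B) := by
  obtain ⟨j, hj, hC⟩ := hC
  have := Submodule.finrank_mono (le_inf (cone_mono hA) (cone_mono hB))
  rw [finrank_cone hC] at this
  omega

lemma dimGe_iInter_of_subset {t : ℕ} {T : Set (Fin n → F)} {ι : Type*}
    {c : ι → Set (Fin n → F)} {k : ι → ℕ} (hT : IsFlat F t T) (hc : ∀ i, IsFlat F (k i) (c i))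
    (hTc : ∀ i, T ⊆ c i) : DimGe F t (⋂ i, c i) := by
  obtain ⟨P, x, hP, rfl⟩ := hT
  have hform : ∀ i, ∃ Q : Submodule F (Fin n → F), P ≤ Q ∧ c i = {v | v - x ∈ Q} := by
    intro i
    obtain ⟨Q, y, -, hQ⟩ := hc i
    have hx : x - y ∈ Q := by
      have : x ∈ c i := hTc i (by simp)
      rwa [hQ] at this
    have he : c i = {v | v - x ∈ Q} := by
      rw [hQ]
      ext v
      have : v - y = (v - x) + (x - y) := by abel
      simp only [Set.mem_ofPred_eq]
      rw [this, Q.add_mem_iff_left hx]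
    refine ⟨Q, fun p hp => ?_, he⟩
    have : p + x ∈ c i := hTc i (by simpa using hp)
    rw [he] at this
    simpa using this
  choose Q hPQ hcQ using hform
  refine ⟨_, ?_, ⨅ i, Q i, x, rfl, ?_⟩
  · rw [← hP]
    exact Submodule.finrank_mono (le_iInf hPQ)
  · ext v
    simp [hcQ]

variable [Finite F]

/-- The cones over the members of a family of flats. -/
noncomputable def cones (A : Set (Set (Fin n → F))) :
    Finset (Submodule F ((Fin n → F) × F)) :=
  ((Set.toFinite A).image cone).toFinset

lemma mem_cones {A : Set (Set (Fin n → F))} {K : Submodule F ((Fin n → F) × F)} :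
    K ∈ cones A ↔ ∃ X ∈ A, cone X = K := by
  simp [cones]

lemma cones_nonempty {A : Set (Set (Fin n → F))} (hA : A.Nonempty) : (cones A).Nonempty :=
  hA.elim fun X hX => ⟨cone X, mem_cones.2 ⟨X, hX, rfl⟩⟩

lemma card_cones {A : Set (Set (Fin n → F))} {k : ℕ} (hA : ∀ X ∈ A, IsFlat F k X) :
    (cones A).card = A.ncard := by
  rw [cones, ← Set.ncard_eq_toFinset_card, Set.InjOn.ncard_image]
  exact fun X hX Y hY h => ((subset_iff_cone_le (hA X hX) (hA Y hY)).2 h.le).antisymm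
    ((subset_iff_cone_le (hA Y hY) (hA X hX)).2 h.ge)

lemma cones_flats_above {t k : ℕ} {T : Set (Fin n → F)} (hT : IsFlat F t T) :
    cones {A | IsFlat F k A ∧ T ⊆ A} = superspaces (cone T) (k + 1) := by
  ext K
  rw [mem_cones, mem_superspaces]
  constructor
  · rintro ⟨X, ⟨hX, hTX⟩, rfl⟩
    exact ⟨cone_mono hTX, finrank_cone hX⟩
  · rintro ⟨hTK, hK⟩
    obtain ⟨A, hA, rfl⟩ := exists_flat_cone_eq K hK fun h => not_cone_le_ker hT (hTK.trans h)
    exact ⟨A, ⟨hA, (subset_iff_cone_le hT hA).2 hTK⟩, rfl⟩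

lemma ncard_flats_above {t j m : ℕ} {T : Set (Fin n → F)} (hT : IsFlat F t T)
    (hm : t + j + m = n) :
    (({A | IsFlat F (t + j) A ∧ T ⊆ A} : Set (Set (Fin n → F))).ncard : ℚ) =
      gauss (Nat.card F) m j := by
  rw [← card_cones (k := t + j) fun X hX => hX.1, cones_flats_above hT,
    card_superspaces (k := t + j + 1) (m := m) (by rw [finrank_cone_space]; omega) j]
  rw [finrank_cone hT]
  omega

lemma eq_flats_above_of_cones_eq {k t : ℕ} {A : Set (Set (Fin n → F))}
    (hA : ∀ X ∈ A, IsFlat F k X) {T : Set (Fin n → F)} (hT : IsFlat F t T)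
    (h : cones A = superspaces (cone T) (k + 1)) : A = {X | IsFlat F k X ∧ T ⊆ X} := by
  ext X
  constructor
  · intro hX
    have : cone X ∈ cones A := mem_cones.2 ⟨X, hX, rfl⟩
    rw [h, mem_superspaces] at this
    exact ⟨hA X hX, (subset_iff_cone_le hT (hA X hX)).2 this.1⟩
  · rintro ⟨hX, hTX⟩
    have : cone X ∈ superspaces (cone T) (k + 1) :=
      mem_superspaces.2 ⟨cone_mono hTX, finrank_cone hX⟩
    rw [← h, mem_cones] at this
    obtain ⟨Y, hY, hYX⟩ := this
    have hY' := hA Y hY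
    have : Y = X := ((subset_iff_cone_le hY' hX).2 hYX.le).antisymm
      ((subset_iff_cone_le hX hY').2 hYX.ge)
    exact this ▸ hY

/-- A subspace whose superspaces of dimension `k + 1 ≤ n` are all cones over `k`-flats is itself
the cone over a flat. -/
lemma exists_flat_of_superspaces_eq_cones {k t : ℕ} {A : Set (Set (Fin n → F))}
    (hA : ∀ X ∈ A, IsFlat F k X) (hk : t ≤ k) (hkn : k < n)
    {T : Submodule F ((Fin n → F) × F)} (hT : finrank F T = t + 1)
    (h : cones A = superspaces T (k + 1)) :
    ∃ X : Set (Fin n → F), IsFlat F t X ∧ cone X = T := by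
  refine exists_flat_cone_eq T hT fun hle => ?_
  have hker : finrank F (LinearMap.ker (LinearMap.snd F (Fin n → F) F)) = n := by
    have h1 := (LinearMap.snd F (Fin n → F) F).finrank_range_add_finrank_ker
    rw [LinearMap.range_eq_top.2 LinearMap.snd_surjective, finrank_top, finrank_self,
      finrank_cone_space] at h1
    omega
  obtain ⟨K, hTK, hKk, hK⟩ := exists_between_finrank_eq hle (k := k + 1) (by omega) (by omega)
  have : K ∈ cones A := h ▸ mem_superspaces.2 ⟨hTK, hK⟩
  obtain ⟨X, hX, rfl⟩ := mem_cones.1 this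
  exact not_cone_le_ker (hA X hX) hKk

/-- The cross-intersecting Erdős–Ko–Rado theorem for two families of flats. -/
lemma ncard_mul_ncard_lt_or_eq_flats_above {t a b : ℕ} {A B : Set (Set (Fin n → F))}
    (hta : t ≤ a) (htb : t ≤ b) (hn : a + b + 3 ≤ n) {T₀ : Set (Fin n → F)}
    (hT₀ : IsFlat F t T₀) (hA0 : A.Nonempty) (hB0 : B.Nonempty)
    (hA : ∀ X ∈ A, IsFlat F a X) (hB : ∀ X ∈ B, IsFlat F b X)
    (hAB : ∀ X ∈ A, ∀ Y ∈ B, t + 1 ≤ finrank F ↥(cone X ⊓ cone Y)) :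
    A.ncard * B.ncard < ({X | IsFlat F a X ∧ T₀ ⊆ X} : Set (Set (Fin n → F))).ncard *
        ({X | IsFlat F b X ∧ T₀ ⊆ X} : Set (Set (Fin n → F))).ncard ∨
      ∃ T : Set (Fin n → F), IsFlat F t T ∧ A = {X | IsFlat F a X ∧ T ⊆ X} ∧
        B = {X | IsFlat F b X ∧ T ⊆ X} := by
  obtain ⟨a, rfl⟩ := Nat.exists_eq_add_of_le hta
  obtain ⟨b, rfl⟩ := Nat.exists_eq_add_of_le htb
  obtain ⟨m, hm⟩ := Nat.exists_eq_add_of_le (show t + a ≤ n by omega)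
  obtain ⟨m', hm'⟩ := Nat.exists_eq_add_of_le (show t + b ≤ n by omega)
  have main := card_mul_card_lt_or_eq_superspaces (t := t + 1) (a := a) (b := b) (m := m)
    (m' := m') (cones A) (cones B) (cones_nonempty hA0)
    (cones_nonempty hB0) ?_ ?_ ?_ ?_ ?_ ?_
  · rcases main with h | ⟨T, hT, h1, h2⟩
    · left
      rw [card_cones hA, card_cones hB, ← ncard_flats_above hT₀ hm.symm,
        ← ncard_flats_above hT₀ hm'.symm] at h
      exact_mod_cast h
    · right
      rw [add_right_comm] at h1 h2
      obtain ⟨X, hX, rfl⟩ := exists_flat_of_superspaces_eq_cones hA hta (by omega) hT h1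
      exact ⟨X, hX, eq_flats_above_of_cones_eq hA hX h1, eq_flats_above_of_cones_eq hB hX h2⟩
  · intro K hK
    obtain ⟨X, hX, rfl⟩ := mem_cones.1 hK
    rw [finrank_cone (hA X hX)]; omega
  · intro K hK
    obtain ⟨X, hX, rfl⟩ := mem_cones.1 hK
    rw [finrank_cone (hB X hX)]; omega
  · intro K hK L hL
    obtain ⟨X, hX, rfl⟩ := mem_cones.1 hK
    obtain ⟨Y, hY, rfl⟩ := mem_cones.1 hL
    exact hAB X hX Y hY
  all_goals rw [finrank_cone_space]; omega

lemma eq_of_flats_above_eq {t k : ℕ} (htk : t ≤ k) (hk : k < n) {T T' : Set (Fin n → F)}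
    (hT : IsFlat F t T) (hT' : IsFlat F t T')
    (h : {X | IsFlat F k X ∧ T ⊆ X} = {X | IsFlat F k X ∧ T' ⊆ X}) : T = T' := by
  have hc := (cones_flats_above (k := k) hT).symm.trans
    ((congrArg cones h).trans (cones_flats_above hT'))
  have e := eq_of_superspaces_eq (by rw [finrank_cone hT]; omega)
    (by rw [finrank_cone hT']; omega) (by rw [finrank_cone_space]; omega) hc
  exact ((subset_iff_cone_le hT hT').2 e.le).antisymm ((subset_iff_cone_le hT' hT).2 e.ge)

end Affine

end CrossEKR

theorem stmt_3 (q : ℕ) (hq : IsPrimePow q)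
    (𝔽 : Type) [Field 𝔽] [Fintype 𝔽] (hcard : Fintype.card 𝔽 = q)
    (d n t : ℕ) (hd : 2 ≤ d) (hn : 0 < n) (ht : 0 < t)
    (k : Fin d → ℕ) (hmono : ∀ i j : Fin d, i ≤ j → k j ≤ k i)
    (hkt : ∀ i, t ≤ k i)
    (hn' : k ⟨0, by omega⟩ + k ⟨1, by omega⟩ + 3 ≤ n)
    (F : Fin d → Set (Set (Fin n → 𝔽)))
    (hF : ∀ i, ∀ A ∈ F i, IsFlat 𝔽 (k i) A)
    (hint : ∀ c : Fin d → Set (Fin n → 𝔽), (∀ i, c i ∈ F i) → DimGe 𝔽 t (⋂ i, c i))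
    (hmax : ∀ G : Fin d → Set (Set (Fin n → 𝔽)),
      (∀ i, ∀ A ∈ G i, IsFlat 𝔽 (k i) A) →
      (∀ c : Fin d → Set (Fin n → 𝔽), (∀ i, c i ∈ G i) → DimGe 𝔽 t (⋂ i, c i)) →
      ∏ i, (G i).ncard ≤ ∏ i, (F i).ncard) :
    ∃ T : Set (Fin n → 𝔽), IsFlat 𝔽 t T ∧
      ∀ i, F i = {A | IsFlat 𝔽 (k i) A ∧ T ⊆ A} := by
  obtain ⟨d, rfl⟩ := Nat.exists_eq_add_of_le' hd
  have hk0 : ∀ i, k i ≤ k 0 := fun i => hmono 0 i (Fin.zero_le i)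
  have hk1 : ∀ i, i ≠ 0 → k i ≤ k 1 := fun i hi => hmono 1 i (Fin.one_le_of_ne_zero hi)
  have hk01 : k 0 + k 1 + 3 ≤ n := hn'
  have hsum : ∀ i j, i ≠ j → k i + k j + 3 ≤ n := by
    intro i j hij
    have := hk0 i
    have := hk0 j
    by_cases hi : i = 0
    · have := hk1 j (fun h => hij (hi.trans h.symm))
      omega
    · have := hk1 i hi
      omega
  have hkn : ∀ i, k i < n := fun i => by have := hk0 i; omega
  obtain ⟨T₀, hT₀⟩ := CrossEKR.exists_isFlat (F := 𝔽) ((hkt 0).trans (hkn 0).le)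
  let G : Fin (d + 2) → Set (Set (Fin n → 𝔽)) := fun i => {A | IsFlat 𝔽 (k i) A ∧ T₀ ⊆ A}
  have hGF : ∏ i, (G i).ncard ≤ ∏ i, (F i).ncard := hmax G (fun i A hA => hA.1)
    fun c hc => CrossEKR.dimGe_iInter_of_subset hT₀ (fun i => (hc i).1) fun i => (hc i).2
  have hGpos : ∀ i, 0 < (G i).ncard := by
    intro i
    obtain ⟨j, hj⟩ := Nat.exists_eq_add_of_le (hkt i)
    obtain ⟨m, hm⟩ := Nat.exists_eq_add_of_le (hkn i).le
    have h := CrossEKR.ncard_flats_above hT₀ (j := j) (m := m) (by omega)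
    rw [← hj] at h
    have hp := CrossEKR.gauss_pos (CrossEKR.two_le_natCard (F := 𝔽)) m j
    rw [← h] at hp
    exact_mod_cast hp
  have hFpos : ∀ i, 0 < (F i).ncard := by
    have := (Finset.prod_pos fun i _ => hGpos i).trans_le hGF
    intro i
    exact Nat.pos_of_ne_zero fun h => this.ne' (Finset.prod_eq_zero (Finset.mem_univ i) h)
  have hFne : ∀ i, (F i).Nonempty := fun i => Set.nonempty_of_ncard_ne_zero (hFpos i).ne'
  choose c₀ hc₀ using hFne
  have hcross : ∀ i j, i ≠ j → ∀ X ∈ F i, ∀ Y ∈ F j,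
      t + 1 ≤ finrank 𝔽 ↥(CrossEKR.cone X ⊓ CrossEKR.cone Y) := by
    intro i j hij X hX Y hY
    let c := Function.update (Function.update c₀ i X) j Y
    have hci : c i = X := by simp [c, hij]
    have hcj : c j = Y := by simp [c]
    have hc : ∀ l, c l ∈ F l := by
      intro l
      by_cases hlj : l = j
      · subst hlj; rwa [hcj]
      by_cases hli : l = i
      · subst hli; rwa [hci]
      · simpa [c, hlj, hli] using hc₀ l
    refine CrossEKR.finrank_cone_inf_cone (hint c hc) ?_ ?_
    · rw [← hci]; exact Set.iInter_subset c i
    · rw [← hcj]; exact Set.iInter_subset c j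
  have hpair := fun i j (hij : i ≠ j) => CrossEKR.ncard_mul_ncard_lt_or_eq_flats_above (hkt i)
    (hkt j) (hsum i j hij) hT₀ ⟨_, hc₀ i⟩ ⟨_, hc₀ j⟩ (hF i) (hF j) (hcross i j hij)
  have hle : ∀ i j, i ≠ j → (F i).ncard * (F j).ncard ≤ (G i).ncard * (G j).ncard := by
    intro i j hij
    rcases hpair i j hij with h | ⟨T, hT, h1, h2⟩
    · exact h.le
    · have hstar : ∀ l, ({A | IsFlat 𝔽 (k l) A ∧ T ⊆ A} : Set (Set (Fin n → 𝔽))).ncard =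
          (G l).ncard := by
        intro l
        obtain ⟨e, he⟩ := Nat.exists_eq_add_of_le (hkt l)
        obtain ⟨m, hm⟩ := Nat.exists_eq_add_of_le (hkn l).le
        have h := CrossEKR.ncard_flats_above hT (j := e) (m := m) (by omega)
        rw [← CrossEKR.ncard_flats_above hT₀ (j := e) (m := m) (by omega), ← he] at h
        exact_mod_cast h
      rw [h1, h2, hstar, hstar]
  have hne : ∀ i : Fin (d + 2), i ≠ i + 1 := fun i h => by simp at h
  have hshift : ∀ u : Fin (d + 2) → ℕ, ∏ i, u (i + 1) = ∏ i, u i := fun u =>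
    Equiv.prod_comp (Equiv.addRight (1 : Fin (d + 2))) u
  have heq : ∀ i, ∃ T : Set (Fin n → 𝔽), IsFlat 𝔽 t T ∧
      F i = {A | IsFlat 𝔽 (k i) A ∧ T ⊆ A} ∧
      F (i + 1) = {A | IsFlat 𝔽 (k (i + 1)) A ∧ T ⊆ A} := by
    intro i
    refine (hpair i (i + 1) (hne i)).resolve_left fun hlt => ?_
    have := Finset.prod_lt_prod (s := Finset.univ)
      (f := fun i => (F i).ncard * (F (i + 1)).ncard)
      (g := fun i => (G i).ncard * (G (i + 1)).ncard)
      (fun i _ => Nat.mul_pos (hFpos i) (hFpos (i + 1))) (fun i _ => hle i _ (hne i))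
      ⟨i, Finset.mem_univ i, hlt⟩
    rw [Finset.prod_mul_distrib, Finset.prod_mul_distrib, hshift fun i => (F i).ncard,
      hshift fun i => (G i).ncard] at this
    exact this.not_ge (Nat.mul_le_mul hGF hGF)
  choose T hT hTF hTF' using heq
  have hTstep : ∀ i, T (i + 1) = T i := fun i =>
    CrossEKR.eq_of_flats_above_eq (hkt (i + 1)) (hkn (i + 1)) (hT _) (hT _)
      ((hTF (i + 1)).symm.trans (hTF' i))
  have hTall : ∀ i, T i = T 0 := by
    intro i
    induction i using Fin.induction with
    | zero => rfl
    | succ i ih => rw [← Fin.coeSucc_eq_succ, hTstep, ih]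
  exact ⟨T 0, hT 0, fun i => hTall i ▸ hTF i⟩
end

section
/- Let q be a prime power and let n, k, s, t be positive integers with n > k, n > s and k ≥ t + 1, s ≥ t + 1. Let S ∈ M(s,n) and let T be a t-flat with T ⊆ S. Then a₀(n,k,s,t) ≤ |{F ∈ M(k,n) : T ⊆ F and dim(F ∩ S) ≥ t + 1}|. -/
open Module Set

section SubspaceCounting

variable {K V : Type*} [Field K] [AddCommGroup V] [Module K V]

/-- Linearly independent `k`-tuples spanning a given `k`-dimensional subspace `W` are the same as
linearly independent `k`-tuples in `W`. -/
def linearIndependentFiberEquiv [FiniteDimensional K V] {k : ℕ} (W : Submodule K V)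
    (hW : finrank K W = k) :
    {s : {s : Fin k → V // LinearIndependent K s} // Submodule.span K (Set.range s.1) = W} ≃
      {s : Fin k → W // LinearIndependent K s} where
  toFun s := ⟨fun i => ⟨s.1.1 i, s.2.le (Submodule.subset_span (Set.mem_range_self i))⟩,
    LinearIndependent.of_comp W.subtype s.1.2⟩
  invFun s := ⟨⟨fun i => (s.1 i : V), s.2.map' W.subtype W.ker_subtype⟩, by
    have hli : LinearIndependent K (fun i => (s.1 i : V)) := s.2.map' W.subtype W.ker_subtype
    refine Submodule.eq_of_le_of_finrank_eq ?_ ?_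
    · rw [Submodule.span_le]
      rintro _ ⟨i, rfl⟩
      exact (s.1 i).2
    · rw [finrank_span_eq_card hli, Fintype.card_fin, hW]⟩
  left_inv _ := rfl
  right_inv _ := rfl

theorem card_linearIndependent_eq_card_submodule_mul [Fintype K] [Finite V] {k : ℕ}
    (hk : k ≤ finrank K V) :
    ∏ i : Fin k, (Fintype.card K ^ finrank K V - Fintype.card K ^ i.val) =
      Nat.card {W : Submodule K V // finrank K W = k} *
        ∏ i : Fin k, (Fintype.card K ^ k - Fintype.card K ^ i.val) := by
  have := Fintype.ofFinite {W : Submodule K V // finrank K W = k}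
  rw [← card_linearIndependent hk]
  let f : {s : Fin k → V // LinearIndependent K s} → {W : Submodule K V // finrank K W = k} :=
    fun s => ⟨Submodule.span K (Set.range s.1), by
      rw [finrank_span_eq_card s.2, Fintype.card_fin]⟩
  rw [← Nat.card_congr (Equiv.sigmaFiberEquiv f), Nat.card_sigma,
    Finset.sum_congr rfl (g := fun _ => ∏ i : Fin k, (Fintype.card K ^ k - Fintype.card K ^ i.val))]
  · simp [Nat.card_eq_fintype_card]
  · rintro ⟨W, hW⟩ -
    have e : {s // f s = ⟨W, hW⟩} ≃ {s : Fin k → W // LinearIndependent K s} :=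
      (Equiv.subtypeEquivRight fun s => by simp [f, Subtype.ext_iff]).trans
        (linearIndependentFiberEquiv W hW)
    rw [Nat.card_congr e, card_linearIndependent hW.ge, hW]

theorem gaussQ_eq_zero_of_lt {q n k : ℕ} (h : n < k) : gaussQ q n k = 0 :=
  Finset.prod_eq_zero (Finset.mem_range.2 h) (by simp)

theorem gaussQ_nonneg {q : ℕ} (hq : 1 ≤ q) (n k : ℕ) : 0 ≤ gaussQ q n k := by
  have hq' : (1 : ℚ) ≤ q := by exact_mod_cast hq
  exact Finset.prod_nonneg fun i _ => div_nonneg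
    (sub_nonneg.2 (one_le_pow₀ hq')) (sub_nonneg.2 (one_le_pow₀ hq'))

theorem gaussQ_mul_prod {q n k : ℕ} (hq : 2 ≤ q) (hk : k ≤ n) :
    gaussQ q n k * ∏ i : Fin k, ((q : ℚ) ^ k - (q : ℚ) ^ i.val) =
      ∏ i : Fin k, ((q : ℚ) ^ n - (q : ℚ) ^ i.val) := by
  have hq' : (1 : ℚ) < q := by exact_mod_cast hq
  rw [gaussQ, ← Fin.prod_univ_eq_prod_range
    (fun i => ((q : ℚ) ^ (n - i) - 1) / ((q : ℚ) ^ (k - i) - 1)), ← Finset.prod_mul_distrib]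
  refine Finset.prod_congr rfl fun i _ => ?_
  have hne : (q : ℚ) ^ (k - i.val) - 1 ≠ 0 :=
    (sub_pos.2 (one_lt_pow₀ hq' (by omega))).ne'
  have hk' : (q : ℚ) ^ k = q ^ (k - i.val) * q ^ i.val := by
    rw [← pow_add, Nat.sub_add_cancel i.2.le]
  have hn' : (q : ℚ) ^ n = q ^ (n - i.val) * q ^ i.val := by
    rw [← pow_add, Nat.sub_add_cancel (i.2.le.trans hk)]
  rw [hk', hn']
  field_simp

/-- The number of `k`-dimensional subspaces of a finite vector space. -/
theorem card_submodule_finrank_eq [Fintype K] [Finite V] (k : ℕ) :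
    (Nat.card {W : Submodule K V // finrank K W = k} : ℚ) =
      gaussQ (Fintype.card K) (finrank K V) k := by
  rcases lt_or_ge (finrank K V) k with h | h
  · have : IsEmpty {W : Submodule K V // finrank K W = k} :=
      ⟨fun W => (W.2 ▸ h).not_ge (Submodule.finrank_le W.1)⟩
    rw [gaussQ_eq_zero_of_lt h, Nat.card_of_isEmpty, Nat.cast_zero]
  · have hq : 2 ≤ Fintype.card K := Fintype.one_lt_card
    have hq' : (1 : ℚ) < (Fintype.card K : ℚ) := by exact_mod_cast hq
    have hcast : ∀ m, k ≤ m → ((∏ i : Fin k,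
        (Fintype.card K ^ m - Fintype.card K ^ i.val) : ℕ) : ℚ) =
        ∏ i : Fin k, ((Fintype.card K : ℚ) ^ m - (Fintype.card K : ℚ) ^ i.val) := by
      intro m hm
      rw [Nat.cast_prod]
      refine Finset.prod_congr rfl fun i _ => ?_
      rw [Nat.cast_sub (Nat.pow_le_pow_right (by omega) (i.2.le.trans hm))]
      push_cast
      rfl
    have hne : ∏ i : Fin k, ((Fintype.card K : ℚ) ^ k - (Fintype.card K : ℚ) ^ i.val) ≠ 0 :=
      Finset.prod_ne_zero_iff.2 fun i _ => (sub_pos.2 (pow_lt_pow_right₀ hq' i.2)).ne'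
    refine mul_right_cancel₀ hne ?_
    rw [gaussQ_mul_prod hq h, ← hcast k le_rfl, ← hcast _ h, ← Nat.cast_mul,
      card_linearIndependent_eq_card_submodule_mul h]

/-- The number of `k`-dimensional subspaces containing a given subspace. -/
theorem card_submodule_ge [Fintype K] [Finite V] (U : Submodule K V) {k : ℕ}
    (hk : finrank K U ≤ k) :
    (Nat.card {W : Submodule K V // U ≤ W ∧ finrank K W = k} : ℚ) =
      gaussQ (Fintype.card K) (finrank K V - finrank K U) (k - finrank K U) := by
  have : Finite (V ⧸ U) := Finite.of_surjective U.mkQ U.mkQ_surjective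
  have hquot := Submodule.finrank_quotient_add_finrank U
  rw [show finrank K V - finrank K U = finrank K (V ⧸ U) by omega, ← card_submodule_finrank_eq]
  congr 1
  refine (Nat.card_congr (((Submodule.comapMkQRelIso U).toEquiv.subtypeEquiv
    (q := fun W : Set.Ici U => finrank K W.1 = k) fun W => ?_).trans
      (Equiv.subtypeSubtypeEquivSubtypeInter (fun W => U ≤ W) fun W => finrank K W = k))).symm
  have h := Submodule.finrank_quotient_add_finrank (W.comap U.mkQ)
  have h' := Submodule.finrank_quotient_add_finrank W
  have he : finrank K (V ⧸ W.comap U.mkQ) = finrank K ((V ⧸ U) ⧸ W) :=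
    LinearEquiv.finrank_eq ((Submodule.quotientQuotientEquivQuotient U (W.comap U.mkQ)
      (U.le_comap_mkQ W)).symm.trans
      (Submodule.quotEquivOfEq _ _ (Submodule.map_comap_eq_of_surjective U.mkQ_surjective W)))
  change _ ↔ finrank K (W.comap U.mkQ) = k
  omega

/-- The number of `k`-dimensional subspaces between two given subspaces. -/
theorem card_submodule_between [Fintype K] [Finite V] {U S : Submodule K V} (hUS : U ≤ S) {k : ℕ}
    (hk : finrank K U ≤ k) :
    (Nat.card {W : Submodule K V // (U ≤ W ∧ W ≤ S) ∧ finrank K W = k} : ℚ) =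
      gaussQ (Fintype.card K) (finrank K S - finrank K U) (k - finrank K U) := by
  have hU : finrank K (U.comap S.subtype) = finrank K U :=
    (Submodule.comapSubtypeEquivOfLe hUS).finrank_eq
  rw [← hU, ← card_submodule_ge _ (hU.trans_le hk)]
  congr 1
  refine (Nat.card_congr (((Submodule.mapIic S).toEquiv.subtypeEquiv
    (q := fun W : Set.Iic S => U ≤ W.1 ∧ finrank K W.1 = k) fun W => ?_).trans
      ((Equiv.subtypeSubtypeEquivSubtypeInter (fun W => W ≤ S)
        fun W => U ≤ W ∧ finrank K W = k).trans
        (Equiv.subtypeEquivRight fun W => by tauto)))).symm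
  change _ ↔ U ≤ W.map S.subtype ∧ finrank K (W.map S.subtype) = k
  have hmap : (U.comap S.subtype).map S.subtype = U := by
    rw [Submodule.map_comap_subtype, inf_eq_right.2 hUS]
  rw [Submodule.finrank_map_subtype_eq, ← Submodule.map_le_map_iff_of_injective
    S.subtype_injective, hmap]

/-- `[j 1]_q - q [j 2]_q` is at most `1`, and it is nonpositive for `j = 0`. -/
theorem gaussQ_one_sub_mul_gaussQ_two_le {q : ℕ} (hq : 2 ≤ q) (j : ℕ) :
    gaussQ q j 1 - q * gaussQ q j 2 ≤ if 1 ≤ j then 1 else 0 := by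
  have hq' : (2 : ℚ) ≤ q := by exact_mod_cast hq
  rcases j with _ | _ | j
  · simp [gaussQ]
  · have : (q : ℚ) - 1 ≠ 0 := by linarith
    simp [gaussQ, Finset.prod_range_succ, this]
  · have h1 : (0 : ℚ) < q - 1 := by linarith
    have h2 : (0 : ℚ) < (q : ℚ) ^ 2 - 1 := by nlinarith
    have hx : (1 : ℚ) ≤ (q : ℚ) ^ j := one_le_pow₀ (by linarith)
    have hx0 : 0 ≤ (q : ℚ) ^ j - 1 := sub_nonneg.2 hx
    have hkey : 0 ≤ (q : ℚ) ^ 3 * (q - 1) * (q ^ j - 1) + q ^ 4 * (q ^ j - 1) ^ 2 := by positivity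
    have e : gaussQ q (j + 2) 1 - q * gaussQ q (j + 2) 2 =
        (q ^ 2 * q ^ j - 1) * (q ^ 2 - 1 - q * (q * q ^ j - 1)) / ((q - 1) * (q ^ 2 - 1)) := by
      have h1' := h1.ne'
      have h2' := h2.ne'
      simp [gaussQ, Finset.prod_range_succ, show j + 2 - 1 = j + 1 from rfl, pow_add]
      field_simp
    rw [e, if_pos (by omega), div_le_one (by positivity)]
    nlinarith [hkey]

open Classical in
/-- Double counting of the pairs `A ≤ F` with `U ≤ A ≤ S`, `dim A = a` and `dim F = k`. -/
theorem sum_gaussQ_finrank_inf [Fintype K] [Finite V] [Fintype (Submodule K V)]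
    {U S : Submodule K V} (hUS : U ≤ S) {a k : ℕ} (ha : finrank K U ≤ a) {N : ℚ}
    (hN : ∀ A : Submodule K V, finrank K A = a →
      (Nat.card {F : Submodule K V // A ≤ F ∧ finrank K F = k} : ℚ) = N) :
    ∑ F : Submodule K V with U ≤ F ∧ finrank K F = k,
        gaussQ (Fintype.card K) (finrank K ↥(F ⊓ S) - finrank K U) (a - finrank K U) =
      gaussQ (Fintype.card K) (finrank K S - finrank K U) (a - finrank K U) * N := by
  have hcount := Finset.sum_card_bipartiteAbove_eq_sum_card_bipartiteBelow
    (s := {A : Submodule K V | (U ≤ A ∧ A ≤ S) ∧ finrank K A = a})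
    (t := {F : Submodule K V | U ≤ F ∧ finrank K F = k}) (fun A F => A ≤ F)
  have hcast := congrArg (Nat.cast (R := ℚ)) hcount
  rw [Nat.cast_sum, Nat.cast_sum] at hcast
  rw [Finset.sum_congr rfl (g := fun _ => N), Finset.sum_const, nsmul_eq_mul] at hcast
  · rw [← card_submodule_between hUS ha, Nat.card_eq_fintype_card, Fintype.card_subtype, hcast]
    refine Finset.sum_congr rfl fun F hF => ?_
    simp only [Finset.mem_filter, Finset.mem_univ, true_and] at hF
    rw [← card_submodule_between (le_inf hF.1 hUS) ha, Nat.card_eq_fintype_card,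
      Fintype.card_subtype, Finset.bipartiteBelow, Finset.filter_filter]
    congr 2
    ext A
    simp only [Finset.mem_filter, Finset.mem_univ, true_and, le_inf_iff]
    tauto
  · intro A hA
    simp only [Finset.mem_filter, Finset.mem_univ, true_and] at hA
    rw [← hN A hA.2, Nat.card_eq_fintype_card, Fintype.card_subtype, Finset.bipartiteAbove,
      Finset.filter_filter]
    congr 2
    ext F
    simp only [Finset.mem_filter, Finset.mem_univ, true_and]
    exact ⟨fun h => ⟨h.2, h.1.2⟩, fun h => ⟨⟨hA.1.1.trans h.1, h.2⟩, h.1⟩⟩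

open Classical in
/-- Lower bound for the number of `k`-dimensional subspaces through `U` that meet `S` in more
than `U`. -/
theorem gaussQ_sub_le_card_submodule [Fintype K] [Finite V]
    {U S : Submodule K V} (hUS : U ≤ S) {k : ℕ} (hk : finrank K U + 1 ≤ k) :
    gaussQ (Fintype.card K) (finrank K S - finrank K U) 1 *
          gaussQ (Fintype.card K) (finrank K V - finrank K U - 1) (k - finrank K U - 1) -
        Fintype.card K * gaussQ (Fintype.card K) (finrank K S - finrank K U) 2 *
          gaussQ (Fintype.card K) (finrank K V - finrank K U - 2) (k - finrank K U - 2) ≤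
      ({F : Submodule K V | finrank K F = k ∧ U ≤ F ∧
        finrank K U + 1 ≤ finrank K ↥(F ⊓ S)}.ncard : ℚ) := by
  have := Fintype.ofFinite (Submodule K V)
  have hq : 2 ≤ Fintype.card K := Fintype.one_lt_card
  have h1 := sum_gaussQ_finrank_inf hUS (a := finrank K U + 1) (k := k) (by omega)
    (N := gaussQ (Fintype.card K) (finrank K V - finrank K U - 1) (k - finrank K U - 1))
    fun A hA => by rw [card_submodule_ge A (hA.trans_le hk), hA, Nat.sub_sub, Nat.sub_sub]
  obtain ⟨N, hN, h2⟩ : ∃ N : ℚ,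
      N ≤ gaussQ (Fintype.card K) (finrank K V - finrank K U - 2) (k - finrank K U - 2) ∧
      ∀ A : Submodule K V, finrank K A = finrank K U + 2 →
        (Nat.card {F : Submodule K V // A ≤ F ∧ finrank K F = k} : ℚ) = N := by
    rcases Nat.lt_or_ge k (finrank K U + 2) with hlt | hge
    · refine ⟨0, gaussQ_nonneg (by omega) _ _, fun A hA => ?_⟩
      have : IsEmpty {F : Submodule K V // A ≤ F ∧ finrank K F = k} := ⟨fun F => by
        have := Submodule.finrank_mono F.2.1
        have := F.2.2
        omega⟩
      rw [Nat.card_of_isEmpty, Nat.cast_zero]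
    · refine ⟨_, le_rfl, fun A hA => ?_⟩
      rw [card_submodule_ge A (hA.trans_le hge), hA, Nat.sub_sub, Nat.sub_sub]
  replace h2 := sum_gaussQ_finrank_inf hUS (a := finrank K U + 2) (k := k) (by omega) h2
  rw [Nat.add_sub_cancel_left] at h1 h2
  calc _ ≤ gaussQ (Fintype.card K) (finrank K S - finrank K U) 1 *
          gaussQ (Fintype.card K) (finrank K V - finrank K U - 1) (k - finrank K U - 1) -
        Fintype.card K * gaussQ (Fintype.card K) (finrank K S - finrank K U) 2 * N :=
        sub_le_sub_left (mul_le_mul_of_nonneg_left hN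
          (mul_nonneg (Nat.cast_nonneg _) (gaussQ_nonneg (by omega) _ _))) _
    _ = ∑ F : Submodule K V with U ≤ F ∧ finrank K F = k,
        (gaussQ (Fintype.card K) (finrank K ↥(F ⊓ S) - finrank K U) 1 -
          Fintype.card K * gaussQ (Fintype.card K) (finrank K ↥(F ⊓ S) - finrank K U) 2) := by
        rw [Finset.sum_sub_distrib, ← Finset.mul_sum, h1, h2, mul_assoc]
    _ ≤ ∑ F : Submodule K V with U ≤ F ∧ finrank K F = k,
        if 1 ≤ finrank K ↥(F ⊓ S) - finrank K U then 1 else 0 :=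
        Finset.sum_le_sum fun F _ => gaussQ_one_sub_mul_gaussQ_two_le hq _
    _ = _ := by
        rw [Finset.sum_boole, Finset.filter_filter, ← Set.ncard_coe_finset]
        congr 2
        ext F
        simp only [Finset.coe_filter, Finset.mem_univ, true_and, Set.mem_ofPred_eq]
        rw [and_assoc, and_left_comm]
        refine and_congr_right fun _ => and_congr_right fun hUF => ?_
        rw [Nat.le_sub_iff_add_le' (Submodule.finrank_mono (le_inf hUF hUS))]

end SubspaceCounting

theorem IsFlat.exists_eq_of_mem {𝔽 : Type} [Field 𝔽] {n k : ℕ} {A : Set (Fin n → 𝔽)}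
    (hA : IsFlat 𝔽 k A) {x : Fin n → 𝔽} (hx : x ∈ A) :
    ∃ P : Submodule 𝔽 (Fin n → 𝔽), finrank 𝔽 P = k ∧ A = {v | v - x ∈ P} := by
  obtain ⟨P, y, hP, rfl⟩ := hA
  refine ⟨P, hP, Set.ext fun v => ?_⟩
  have := P.sub_mem_iff_left (x := v - y) hx
  rwa [sub_sub_sub_cancel_right, Iff.comm] at this

theorem setOf_sub_mem_subset_iff {R M : Type*} [Ring R] [AddCommGroup M] [Module R M]
    {P Q : Submodule R M} (x : M) : {v | v - x ∈ P} ⊆ {v | v - x ∈ Q} ↔ P ≤ Q :=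
  ⟨fun h v hv => by simpa using @h (v + x) (by simpa using hv), fun h _ hv => h hv⟩



theorem stmt_9 (q : ℕ) (hq : IsPrimePow q)
    (𝔽 : Type) [Field 𝔽] [Fintype 𝔽] (hcard : Fintype.card 𝔽 = q)
    (n k s t : ℕ) (ht : 0 < t)
    (hnk : k < n) (hns : s < n) (hkt : t + 1 ≤ k) (hst : t + 1 ≤ s)
    (S T : Set (Fin n → 𝔽)) (hS : IsFlat 𝔽 s S) (hT : IsFlat 𝔽 t T) (hTS : T ⊆ S) :
    gaussQ q (s - t) 1 * gaussQ q (n - t - 1) (k - t - 1)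
        - q * gaussQ q (s - t) 2 * gaussQ q (n - t - 2) (k - t - 2)
      ≤ ({F : Set (Fin n → 𝔽) |
            IsFlat 𝔽 k F ∧ T ⊆ F ∧ DimGe 𝔽 (t + 1) (F ∩ S)}.ncard : ℚ) := by
  obtain ⟨U, y, hU, hTU⟩ := hT
  have hyT : y ∈ T := by simp [hTU]
  obtain ⟨W, hW, rfl⟩ := hS.exists_eq_of_mem (hTS hyT)
  subst hTU hcard hU hW
  have hUW : U ≤ W := (setOf_sub_mem_subset_iff y).1 hTS
  have hmain := gaussQ_sub_le_card_submodule hUW hkt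
  rw [Module.finrank_fin_fun] at hmain
  refine hmain.trans (Nat.cast_le.2 (Set.ncard_le_ncard_of_injOn
    (fun F => {v | v - y ∈ F}) ?_ ?_ (Set.toFinite _)))
  · rintro F ⟨hF, hUF, hdim⟩
    exact ⟨⟨F, y, hF, rfl⟩, (setOf_sub_mem_subset_iff y).2 hUF, _, hdim, F ⊓ W, y, rfl, rfl⟩
  · intro F _ G _ hFG
    exact le_antisymm ((setOf_sub_mem_subset_iff y).1 hFG.le)
      ((setOf_sub_mem_subset_iff y).1 hFG.ge)
end

section
/- Let q be a prime power and let n, b, c, t be positive integers with n ≥ b + c + 3, b ≥ t + 1 and c ≥ t. For x ∈ {t, t+1, …, b} set h_{b,c}(x) = q^{x−t} · [x t]_q · [c−t+1 1]_q^{x−t} · [n−x b−x]_q. Then h_{b,c} is strictly decreasing on {t,…,b}: for every x with t ≤ x ≤ b − 1, h_{b,c}(x+1) < h_{b,c}(x). -/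
open Module Set

theorem gaussQ_succ_left_mul (q n k : ℕ) :
    gaussQ q (n + 1) k * ((q : ℚ) ^ (n + 1 - k) - 1) = gaussQ q n k * ((q : ℚ) ^ (n + 1) - 1) := by
  have h : (∏ i ∈ Finset.range k, ((q : ℚ) ^ (n + 1 - i) - 1)) * ((q : ℚ) ^ (n + 1 - k) - 1)
      = (∏ i ∈ Finset.range k, ((q : ℚ) ^ (n - i) - 1)) * ((q : ℚ) ^ (n + 1) - 1) := by
    rw [← Finset.prod_range_succ (fun i => (q : ℚ) ^ (n + 1 - i) - 1), Finset.prod_range_succ']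
    simp
  simp only [gaussQ, Finset.prod_div_distrib]
  rw [div_mul_eq_mul_div, h, div_mul_eq_mul_div]

theorem gaussQ_succ_succ (q n k : ℕ) :
    gaussQ q (n + 1) (k + 1)
      = gaussQ q n k * (((q : ℚ) ^ (n + 1) - 1) / ((q : ℚ) ^ (k + 1) - 1)) := by
  simp only [gaussQ, Finset.prod_range_succ', Nat.add_sub_add_right, Nat.sub_zero]

theorem gaussQ_one_right (q n : ℕ) : gaussQ q n 1 = ((q : ℚ) ^ n - 1) / ((q : ℚ) - 1) := by
  simp [gaussQ]

theorem gaussQ_pos {q n k : ℕ} (hq : 2 ≤ q) (h : k ≤ n) : 0 < gaussQ q n k := by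
  have hq' : (1 : ℚ) < q := by exact_mod_cast hq
  refine Finset.prod_pos fun i hi => ?_
  have hi := Finset.mem_range.1 hi
  exact div_pos (sub_pos.2 (one_lt_pow₀ hq' (by omega))) (sub_pos.2 (one_lt_pow₀ hq' (by omega)))

/-- The cross-multiplied form of the statement that consecutive values have ratio below one. -/
theorem mul_pow_sub_one_lt {Q : ℚ} (hQ : 2 ≤ Q) (t k d m e : ℕ) :
    Q * (Q ^ (t + k + 1) - 1) * (Q ^ (d + 1) - 1) * (Q ^ (m + 1) - 1)
      < (Q ^ (k + 1) - 1) * (Q - 1) * (Q ^ (m + 1 + (t + d + 3) + e) - 1) := by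
  have hQ1 : 1 < Q := by linarith
  have pow_ge (j : ℕ) : 1 ≤ Q ^ j := one_le_pow₀ hQ1.le
  have sub_pos' (j : ℕ) : 0 < Q ^ (j + 1) - 1 := sub_pos.2 (one_lt_pow₀ hQ1 j.succ_ne_zero)
  have hA : Q ^ (t + k + 1) - 1 ≤ Q ^ (t + 1) * (Q ^ (k + 1) - 1) := by
    have h1 : Q ^ (t + 1) ≤ Q ^ (t + k + 1) := pow_le_pow_right₀ hQ1.le (by omega)
    have h2 : Q ^ (t + 1) * Q ^ (k + 1) = Q ^ (t + k + 1) * Q := by ring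
    nlinarith [pow_ge (t + k + 1)]
  have hB : Q ^ (d + 1) - 1 < Q ^ (d + 1) * (Q - 1) := by nlinarith [pow_ge (d + 1)]
  have hC : Q ^ (t + d + 3) * (Q ^ (m + 1) - 1) ≤ Q ^ (m + 1 + (t + d + 3) + e) - 1 := by
    have h1 : Q ^ (m + 1 + (t + d + 3)) ≤ Q ^ (m + 1 + (t + d + 3) + e) :=
      pow_le_pow_right₀ hQ1.le (by omega)
    have h2 := pow_add Q (m + 1) (t + d + 3)
    nlinarith [pow_ge (t + d + 3)]
  have hQ0 : 0 < Q - 1 := by linarith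
  have hk := sub_pos' k
  have hd := sub_pos' d
  have hm := sub_pos' m
  calc Q * (Q ^ (t + k + 1) - 1) * (Q ^ (d + 1) - 1) * (Q ^ (m + 1) - 1)
      ≤ Q * (Q ^ (t + 1) * (Q ^ (k + 1) - 1)) * (Q ^ (d + 1) - 1) * (Q ^ (m + 1) - 1) := by
        gcongr
    _ < Q * (Q ^ (t + 1) * (Q ^ (k + 1) - 1)) * (Q ^ (d + 1) * (Q - 1)) * (Q ^ (m + 1) - 1) := by
        gcongr
    _ = (Q ^ (k + 1) - 1) * (Q - 1) * (Q ^ (t + d + 3) * (Q ^ (m + 1) - 1)) := by ring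
    _ ≤ _ := by gcongr

theorem stmt_12 (q : ℕ) (hq : IsPrimePow q)
    (n b c t : ℕ) (ht : 0 < t) (hn : b + c + 3 ≤ n) (hb : t + 1 ≤ b) (hc : t ≤ c)
    (x : ℕ) (hx1 : t ≤ x) (hx2 : x ≤ b - 1) :
    (q : ℚ) ^ (x + 1 - t) * gaussQ q (x + 1) t * gaussQ q (c - t + 1) 1 ^ (x + 1 - t)
        * gaussQ q (n - (x + 1)) (b - (x + 1))
      < (q : ℚ) ^ (x - t) * gaussQ q x t * gaussQ q (c - t + 1) 1 ^ (x - t)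
        * gaussQ q (n - x) (b - x) := by
  have hq2 : 2 ≤ q := hq.two_le
  have hQ : (2 : ℚ) ≤ q := by exact_mod_cast hq2
  obtain ⟨k, rfl⟩ := Nat.exists_eq_add_of_le hx1
  obtain ⟨d, rfl⟩ := Nat.exists_eq_add_of_le hc
  obtain ⟨m, rfl⟩ : ∃ m, b = t + k + 1 + m := Nat.exists_eq_add_of_le (by omega)
  obtain ⟨e, rfl⟩ := Nat.exists_eq_add_of_le hn
  rw [show t + k + 1 - t = k + 1 by omega, show t + k - t = k by omega,
    show t + d - t + 1 = d + 1 by omega,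
    show t + k + 1 + m + (t + d) + 3 + e - (t + k + 1) = m + (t + d + 3) + e by omega,
    show t + k + 1 + m - (t + k + 1) = m by omega,
    show t + k + 1 + m + (t + d) + 3 + e - (t + k) = m + (t + d + 3) + e + 1 by omega,
    show t + k + 1 + m - (t + k) = m + 1 by omega, gaussQ_succ_succ q _ m]
  have hx := gaussQ_succ_left_mul q (t + k) t
  rw [show t + k + 1 - t = k + 1 by omega] at hx
  have hG : 0 < gaussQ q (t + k) t := gaussQ_pos hq2 (by omega)
  have hH : 0 < gaussQ q (m + (t + d + 3) + e) m := gaussQ_pos hq2 (by omega)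
  have hD : 0 < gaussQ q (d + 1) 1 := gaussQ_pos hq2 (by omega)
  have hk : (0 : ℚ) < (q : ℚ) ^ (k + 1) - 1 :=
    sub_pos.2 (one_lt_pow₀ (by linarith) k.succ_ne_zero)
  have hm : (0 : ℚ) < (q : ℚ) ^ (m + 1) - 1 :=
    sub_pos.2 (one_lt_pow₀ (by linarith) m.succ_ne_zero)
  have hQ1 : (0 : ℚ) < (q : ℚ) - 1 := by linarith
  have key := mul_pow_sub_one_lt hQ t k d m e
  rw [show m + 1 + (t + d + 3) + e = m + (t + d + 3) + e + 1 by omega] at key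
  have ratio : q * (((q : ℚ) ^ (t + k + 1) - 1) / ((q : ℚ) ^ (k + 1) - 1)) * gaussQ q (d + 1) 1
      < ((q : ℚ) ^ (m + (t + d + 3) + e + 1) - 1) / ((q : ℚ) ^ (m + 1) - 1) := by
    rw [gaussQ_one_right, ← mul_div_assoc (q : ℚ), div_mul_div_comm, div_lt_div_iff₀ (by positivity) hm]
    linarith
  rw [← eq_div_iff hk.ne'] at hx
  have hpos : 0 < (q : ℚ) ^ k * gaussQ q (t + k) t * gaussQ q (d + 1) 1 ^ k
      * gaussQ q (m + (t + d + 3) + e) m := by positivity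
  calc _ = _ := by rw [hx]; ring
    _ < _ := mul_lt_mul_of_pos_left ratio hpos
    _ = _ := by ring
end
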